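/- arXiv:2211.15232 — 4 statements merged into one kernel-verified Lean document; each statement's English description precedes it below -/
import Mathlib

section
/- Assume μ has finite second moment and σ is X-controlled. Then there exists a positive semidefinite symmetric matrix A ∈ M_d(ℝ) such that, uniformly in x ∈ X, (1/n) ∫_G σ(g,x) σ(g,x)ᵀ dμ^{*n}(g) converges to A as n → ∞; that is, sup_{x∈X} ‖(1/n) ∫_G σ(g,x) σ(g,x)ᵀ dμ^{*n}(g) − A‖ → 0. -/
open MeasureTheory Filter Topology
open scoped ENNReal NNReal

noncomputable section

/-- The group element `b_n ⋯ b_1`, where `b_i` is coordinate `i - 1` of `b`. -/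
def prodRev {G : Type*} [Monoid G] (b : ℕ → G) : ℕ → G
  | 0 => 1
  | n + 1 => b n * prodRev b n

/-- The `n`-th convolution power of `μ`: the law of `b_n ⋯ b_1` for i.i.d. `b_i` of law `μ`. -/
def convPow {G : Type*} [Monoid G] [MeasurableSpace G] (μ : Measure G) : ℕ → Measure G
  | 0 => Measure.dirac 1
  | n + 1 => (μ.prod (convPow μ n)).map fun p => p.1 * p.2


/-- scalar centered cocycle dominated by a square integrable function -/
structure ScalCoc {G : Type*} [Group G] [MeasurableSpace G]
    {X : Type*} [MeasurableSpace X] [MulAction G X]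
    (c : G → X → ℝ) (N : G → ℝ) (μ : Measure G) : Prop where
  act : Measurable fun p : G × X => p.1 • p.2
  meas : Measurable fun p : G × X => c p.1 p.2
  coc : ∀ g₁ g₂ : G, ∀ x : X, c (g₂ * g₁) x = c g₂ (g₁ • x) + c g₁ x
  bd : ∀ g x, |c g x| ≤ N g
  mem : MemLp N 2 μ
  drift : ∀ x, ∫ g, c g x ∂μ = 0

section aux

set_option linter.unusedSectionVars false

theorem int_mul {Ω : Type*} [MeasurableSpace Ω] {P : Measure Ω} {f f' : Ω → ℝ}
    (h : MemLp f 2 P) (h' : MemLp f' 2 P) : Integrable (fun w => f w * f' w) P :=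
  h.integrable_mul h'

theorem int_add4 {Ω : Type*} [MeasurableSpace Ω] {P : Measure Ω} {f₁ f₂ f₃ f₄ : Ω → ℝ}
    (h₁ : Integrable f₁ P) (h₂ : Integrable f₂ P) (h₃ : Integrable f₃ P) (h₄ : Integrable f₄ P) :
    ∫ w, (f₁ w + f₂ w + f₃ w + f₄ w) ∂P = ∫ w, f₁ w ∂P + ∫ w, f₂ w ∂P + ∫ w, f₃ w ∂P
      + ∫ w, f₄ w ∂P := by
  rw [integral_add (f := fun w => f₁ w + f₂ w + f₃ w) ((h₁.add h₂).add h₃) h₄,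
    integral_add (f := fun w => f₁ w + f₂ w) (h₁.add h₂) h₃, integral_add h₁ h₂]

theorem ib_add {Ω : Type*} [MeasurableSpace Ω] {P : Measure Ω} {f g : Ω → ℝ} {a b : ℝ}
    (hf : Integrable f P ∧ ∫ w, f w ∂P ≤ a) (hg : Integrable g P ∧ ∫ w, g w ∂P ≤ b) :
    Integrable (fun w => f w + g w) P ∧ ∫ w, (f w + g w) ∂P ≤ a + b :=
  ⟨hf.1.add hg.1, by rw [integral_add hf.1 hg.1]; exact add_le_add hf.2 hg.2⟩

theorem ib_mul {Ω : Type*} [MeasurableSpace Ω] {P : Measure Ω} {f : Ω → ℝ} {a k : ℝ} (hk : 0 ≤ k)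
    (hf : Integrable f P ∧ ∫ w, f w ∂P ≤ a) :
    Integrable (fun w => k * f w) P ∧ ∫ w, (k * f w) ∂P ≤ k * a :=
  ⟨hf.1.const_mul k, by rw [integral_const_mul]; exact mul_le_mul_of_nonneg_left hf.2 hk⟩

/-- projection on `[-m, m]` -/
def clip (m s : ℝ) : ℝ := max (-m) (min s m)

/-- squared distance to `[-m, m]` -/
def hh (m s : ℝ) : ℝ := (s - clip m s) ^ 2

theorem clip_cases {m : ℝ} (hm : 0 ≤ m) (s : ℝ) :
    (s ≤ -m ∧ clip m s = -m) ∨ (|s| ≤ m ∧ clip m s = s) ∨ (m ≤ s ∧ clip m s = m) := by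
  unfold clip
  rcases le_total s (-m) with h | h
  · left; refine ⟨h, ?_⟩
    rw [min_eq_left (by linarith), max_eq_left h]
  rcases le_total s m with h' | h'
  · right; left; refine ⟨abs_le.2 ⟨h, h'⟩, ?_⟩
    rw [min_eq_left h', max_eq_right h]
  · right; right; refine ⟨h', ?_⟩
    rw [min_eq_right h', max_eq_right (by linarith)]

theorem abs_sub_clip_le {m : ℝ} (hm : 0 ≤ m) (s : ℝ) : |s - clip m s| ≤ |s| := by
  rcases clip_cases hm s with ⟨h, e⟩ | ⟨h, e⟩ | ⟨h, e⟩ <;> rw [e]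
  · rw [abs_of_nonpos (by linarith), abs_of_nonpos (by linarith)]; linarith
  · simp
  · rw [abs_of_nonneg (by linarith), abs_of_nonneg (by linarith)]; linarith

theorem hh_eq_zero {m : ℝ} (hm : 0 ≤ m) {s : ℝ} (hs : |s| ≤ m) : s - clip m s = 0 := by
  rw [abs_le] at hs
  unfold clip
  rw [min_eq_left hs.2, max_eq_right hs.1, sub_self]

theorem hh_le_sq {m : ℝ} (hm : 0 ≤ m) (s t : ℝ) : hh m t ≤ (t - clip m s) ^ 2 := by
  unfold hh
  have h1 : -m ≤ clip m s ∧ clip m s ≤ m := by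
    rcases clip_cases hm s with ⟨h, e⟩ | ⟨h, e⟩ | ⟨h, e⟩ <;> rw [e]
    · constructor <;> linarith
    · exact abs_le.1 h
    · constructor <;> linarith
  rcases clip_cases hm t with ⟨h, e⟩ | ⟨h, e⟩ | ⟨h, e⟩ <;> rw [e]
  · nlinarith
  · rw [sub_self]; nlinarith [sq_nonneg (t - clip m s)]
  · nlinarith

theorem sq_le_hh {m : ℝ} (hm : 0 ≤ m) (s : ℝ) : s * s ≤ 2 * hh m s + 2 * m ^ 2 := by
  unfold hh
  rcases clip_cases hm s with ⟨h, e⟩ | ⟨h, e⟩ | ⟨h, e⟩ <;> rw [e]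
  · nlinarith [sq_nonneg (s + 2 * m)]
  · rw [← abs_mul_abs_self]; nlinarith [abs_nonneg s]
  · nlinarith [sq_nonneg (s - 2 * m)]

theorem hh_step {m : ℝ} (hm : 0 < m) (s u ν : ℝ) (hu : |u| ≤ ν) :
    hh m (u + s) ≤ hh m s + (2 * (s - clip m s)) * u + ν ^ 2 * (4 / m ^ 2 * (s * s))
      + (if m / 2 < ν then ν ^ 2 else 0) := by
  have hu2 : u ^ 2 ≤ ν ^ 2 := by rw [← sq_abs]; exact pow_le_pow_left₀ (abs_nonneg _) hu 2
  have key : hh m (u + s) ≤ hh m s + (2 * (s - clip m s)) * u + u ^ 2 := by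
    refine (hh_le_sq hm.le s _).trans (le_of_eq ?_)
    unfold hh; ring
  have p1 : 0 ≤ ν ^ 2 * (4 / m ^ 2 * (s * s)) := by
    have := mul_self_nonneg s
    positivity
  split_ifs with hν
  · linarith
  · rcases le_or_gt |s| (m / 2) with hs | hs
    · have hsu : |u + s| ≤ m := by
        refine (abs_add_le _ _).trans ?_
        linarith
      have e1 := hh_eq_zero hm.le hsu
      have e2 := hh_eq_zero hm.le (hs.trans (by linarith))
      unfold hh
      rw [e1, e2]
      linarith
    · have : 1 ≤ 4 / m ^ 2 * (s * s) := by
        rw [div_mul_eq_mul_div, le_div_iff₀ (by positivity), ← abs_mul_abs_self s]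
        nlinarith
      nlinarith [sq_nonneg ν]

theorem measurable_clip (m : ℝ) : Measurable (clip m) := by
  unfold clip; fun_prop

theorem measurable_hh (m : ℝ) : Measurable (hh m) := by
  unfold hh
  exact (measurable_id.sub (measurable_clip m)).pow_const 2

variable {G : Type*} [Group G] [MeasurableSpace G] [MeasurableMul₂ G]
  {X : Type*} [MeasurableSpace X] [MulAction G X]
  {c c' : G → X → ℝ} {N : G → ℝ} {μ : Measure G} [IsProbabilityMeasure μ]

instance convPow_prob (n : ℕ) : IsProbabilityMeasure (convPow μ n) := by
  induction n with
  | zero => unfold convPow; infer_instance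
  | succ n ih =>
    unfold convPow
    exact Measure.isProbabilityMeasure_map (measurable_mul (M := G)).aemeasurable

theorem convPow_succ (n : ℕ) : convPow μ (n + 1) = Measure.mconv μ (convPow μ n) := rfl

theorem convPow_add (m n : ℕ) :
    convPow μ (m + n) = Measure.mconv (convPow μ m) (convPow μ n) := by
  induction m with
  | zero =>
    rw [Nat.zero_add]
    change _ = Measure.mconv (Measure.dirac 1) _
    rw [Measure.dirac_one_mconv]
  | succ m ih =>
    rw [Nat.add_right_comm, convPow_succ, convPow_succ, ih, Measure.mconv_assoc]

theorem convPow_one : convPow μ 1 = μ := by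
  rw [convPow_succ]
  change Measure.mconv μ (Measure.dirac 1) = _
  rw [Measure.mconv_dirac_one]

theorem integral_convPow_add (m n : ℕ) {f : G → ℝ} (hf : Measurable f) :
    ∫ g, f g ∂convPow μ (m + n) = ∫ p : G × G, f (p.1 * p.2) ∂((convPow μ m).prod (convPow μ n)) := by
  rw [convPow_add, Measure.mconv, integral_map (measurable_mul (M := G)).aemeasurable
    hf.aestronglyMeasurable]

namespace ScalCoc

theorem meas_left (h : ScalCoc c N μ) (x : X) : Measurable fun g => c g x :=
  h.meas.comp (measurable_id.prodMk measurable_const)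

theorem meas_act (h : ScalCoc c N μ) (x : X) : Measurable fun p : G × G => c p.1 (p.2 • x) := by
  have h1 : Measurable fun g : G => g • x := h.act.comp (measurable_id.prodMk measurable_const)
  exact h.meas.comp (measurable_fst.prodMk (h1.comp measurable_snd))

theorem memLp (h : ScalCoc c N μ) (n : ℕ) (x : X) : MemLp (fun g => c g x) 2 (convPow μ n) := by
  induction n with
  | zero =>
    refine MemLp.mono' (g := fun _ => |c 1 x|) (memLp_const _)
      (h.meas_left x).aestronglyMeasurable ?_
    change ∀ᵐ a ∂(Measure.dirac 1), _
    have hm : MeasurableSet {g : G | ‖c g x‖ ≤ |c 1 x|} :=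
      measurableSet_le (h.meas_left x).norm measurable_const
    rw [ae_dirac_iff hm]
    simp
  | succ n ih =>
    rw [convPow_succ, Measure.mconv, memLp_map_measure_iff (h.meas_left x).aestronglyMeasurable
      (measurable_mul (M := G)).aemeasurable]
    have h1 : MemLp (fun p : G × G => c p.1 (p.2 • x)) 2 (μ.prod (convPow μ n)) :=
      MemLp.mono' (h.mem.comp_fst _) (h.meas_act x).aestronglyMeasurable
        (Eventually.of_forall fun p => h.bd _ _)
    refine (h1.add (ih.comp_snd μ)).congr_norm ?_ ?_
    · exact ((h.meas_left x).comp (measurable_mul (M := G))).aestronglyMeasurable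
    · refine Eventually.of_forall fun p => ?_
      simp [h.coc]

theorem memLp_mul (h : ScalCoc c N μ) (m n : ℕ) (x : X) :
    MemLp (fun p : G × G => c (p.1 * p.2) x) 2 ((convPow μ m).prod (convPow μ n)) := by
  have := h.memLp (m + n) x
  rw [convPow_add, Measure.mconv, memLp_map_measure_iff (h.meas_left x).aestronglyMeasurable
      (measurable_mul (M := G)).aemeasurable] at this
  exact this

theorem memLp_act (h : ScalCoc c N μ) (m n : ℕ) (x : X) :
    MemLp (fun p : G × G => c p.1 (p.2 • x)) 2 ((convPow μ m).prod (convPow μ n)) := by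
  have := (h.memLp_mul m n x).sub ((h.memLp n x).comp_snd (convPow μ m))
  convert this using 1
  ext p
  simp [h.coc]

theorem integral_eq_zero (h : ScalCoc c N μ) (n : ℕ) (x : X) :
    ∫ g, c g x ∂convPow μ n = 0 := by
  induction n with
  | zero =>
    change ∫ g, c g x ∂(Measure.dirac 1) = 0
    rw [integral_dirac' _ _ (h.meas_left x).stronglyMeasurable]
    have := h.coc 1 1 x
    simpa using this
  | succ n ih =>
    rw [Nat.add_comm, integral_convPow_add _ _ (h.meas_left x)]
    simp_rw [h.coc]
    rw [integral_add ((h.memLp_act 1 n x).integrable (by norm_num))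
      (((h.memLp n x).comp_snd _).integrable (by norm_num)),
      integral_prod_symm _ ((h.memLp_act 1 n x).integrable (by norm_num)),
      integral_fun_snd (fun g => c g x), ih]
    simp [convPow_one, h.drift]

theorem cross_zero (h : ScalCoc c N μ) (m n : ℕ) (x : X) {f : G → ℝ}
    (hf : MemLp f 2 (convPow μ n)) :
    ∫ p : G × G, f p.2 * c p.1 (p.2 • x) ∂((convPow μ m).prod (convPow μ n)) = 0 := by
  rw [integral_prod_symm _ (int_mul (hf.comp_snd _) (h.memLp_act m n x))]
  simp_rw [integral_const_mul, h.integral_eq_zero]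
  simp

theorem cov_add (h : ScalCoc c N μ) (h' : ScalCoc c' N μ) (m n : ℕ) (x : X) :
    ∫ g, c g x * c' g x ∂convPow μ (m + n) = ∫ g, c g x * c' g x ∂convPow μ n
      + ∫ g, (∫ k, c k (g • x) * c' k (g • x) ∂convPow μ m) ∂convPow μ n := by
  rw [integral_convPow_add (f := fun g => c g x * c' g x) _ _
    ((h.meas_left x).mul (h'.meas_left x))]
  have e : ∀ p : G × G, c (p.1 * p.2) x * c' (p.1 * p.2) x =
      ((c p.2 x * c' p.2 x + c p.1 (p.2 • x) * c' p.1 (p.2 • x)) + c p.2 x * c' p.1 (p.2 • x))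
        + c' p.2 x * c p.1 (p.2 • x) := by
    intro p; rw [h.coc, h'.coc]; ring
  simp_rw [e]
  have i1 : Integrable (fun p : G × G => c p.2 x * c' p.2 x)
      ((convPow μ m).prod (convPow μ n)) :=
    int_mul ((h.memLp n x).comp_snd _) ((h'.memLp n x).comp_snd _)
  have i2 : Integrable (fun p : G × G => c p.1 (p.2 • x) * c' p.1 (p.2 • x))
      ((convPow μ m).prod (convPow μ n)) :=
    int_mul (h.memLp_act m n x) (h'.memLp_act m n x)
  have i3 : Integrable (fun p : G × G => c p.2 x * c' p.1 (p.2 • x))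
      ((convPow μ m).prod (convPow μ n)) :=
    int_mul ((h.memLp n x).comp_snd _) (h'.memLp_act m n x)
  have i4 : Integrable (fun p : G × G => c' p.2 x * c p.1 (p.2 • x))
      ((convPow μ m).prod (convPow μ n)) :=
    int_mul ((h'.memLp n x).comp_snd _) (h.memLp_act m n x)
  rw [int_add4 i1 i2 i3 i4,
    h.cross_zero m n x (h'.memLp n x), h'.cross_zero m n x (h.memLp n x),
    integral_prod_symm _ i2, integral_fun_snd (fun g => c g x * c' g x)]
  simp

theorem cov_int (h : ScalCoc c N μ) (h' : ScalCoc c' N μ) (m n : ℕ) (x : X) :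
    Integrable (fun g => ∫ k, c k (g • x) * c' k (g • x) ∂convPow μ m) (convPow μ n) :=
  Integrable.integral_prod_right (int_mul (h.memLp_act m n x) (h'.memLp_act m n x))

theorem sq_le (h : ScalCoc c N μ) (n : ℕ) (x : X) :
    ∫ g, c g x * c g x ∂convPow μ n ≤ n * ∫ g, N g ^ 2 ∂μ := by
  induction n with
  | zero =>
    change ∫ g, c g x * c g x ∂(Measure.dirac 1) ≤ _
    rw [integral_dirac' (fun g => c g x * c g x) _ ((h.meas_left x).mul (h.meas_left x)).stronglyMeasurable]
    have := h.coc 1 1 x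
    have h0 : c 1 x = 0 := by simpa using this
    simp [h0]
  | succ n ih =>
    rw [Nat.add_comm, h.cov_add h]
    have h1 : ∫ g, (∫ k, c k (g • x) * c k (g • x) ∂convPow μ 1) ∂convPow μ n
        ≤ ∫ _g, (∫ k, N k ^ 2 ∂μ) ∂convPow μ n := by
      refine integral_mono (h.cov_int h 1 n x) (integrable_const _) fun g => ?_
      change ∫ k, c k (g • x) * c k (g • x) ∂convPow μ 1 ≤ _
      refine (integral_mono (int_mul (h.memLp 1 _) (h.memLp 1 _))
        (g := fun k => N k ^ 2) ?_ ?_).trans (le_of_eq ?_)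
      · rw [convPow_one]; exact h.mem.integrable_sq
      · intro k
        have := h.bd k (g • x)
        change c k (g • x) * c k (g • x) ≤ N k ^ 2
        rw [← sq, ← sq_abs]
        exact pow_le_pow_left₀ (abs_nonneg _) this 2
      · rw [convPow_one]
    simp only [integral_const, probReal_univ, one_smul] at h1
    push_cast
    linarith

theorem cov_le (h : ScalCoc c N μ) (h' : ScalCoc c' N μ) (n : ℕ) (x : X) :
    |∫ g, c g x * c' g x ∂convPow μ n| ≤ n * ∫ g, N g ^ 2 ∂μ := by
  have a := h.sq_le n x
  have b := h'.sq_le n x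
  have ia := int_mul (h.memLp n x) (h.memLp n x)
  have ib := int_mul (h'.memLp n x) (h'.memLp n x)
  have iab := int_mul (h.memLp n x) (h'.memLp n x)
  have : ∫ g, |c g x * c' g x| ∂convPow μ n
      ≤ ∫ g, (1/2 * (c g x * c g x) + 1/2 * (c' g x * c' g x)) ∂convPow μ n := by
    refine integral_mono iab.abs ((ia.const_mul _).add (ib.const_mul _)) fun g => ?_
    change |c g x * c' g x| ≤ 1/2 * (c g x * c g x) + 1/2 * (c' g x * c' g x)
    rw [abs_le]
    constructor <;> nlinarith [sq_nonneg (c g x + c' g x), sq_nonneg (c g x - c' g x)]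
  rw [integral_add (ia.const_mul _) (ib.const_mul _), integral_const_mul, integral_const_mul] at this
  have := abs_integral_le_integral_abs (f := fun g => c g x * c' g x) (μ := convPow μ n)
  linarith

end ScalCoc

/-- tail of the second moment -/
def tau (N : G → ℝ) (μ : Measure G) (m : ℝ) : ℝ := ∫ g, (if m / 2 < N g then N g ^ 2 else 0) ∂μ

theorem tau_aesm (hN : MemLp N 2 μ) (m : ℝ) :
    AEStronglyMeasurable (fun g => if m / 2 < N g then N g ^ 2 else 0) μ := by
  have h1 : Measurable fun t : ℝ => if m / 2 < t then t ^ 2 else 0 :=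
    Measurable.ite measurableSet_Ioi (by fun_prop) measurable_const
  exact (h1.comp_aemeasurable hN.1.aemeasurable).aestronglyMeasurable

theorem tau_bd (m : ℝ) (g : G) : ‖(if m / 2 < N g then N g ^ 2 else 0 : ℝ)‖ ≤ N g ^ 2 := by
  split_ifs
  · rw [Real.norm_eq_abs, abs_of_nonneg (sq_nonneg _)]
  · simpa using sq_nonneg (N g)

theorem tau_int (hN : MemLp N 2 μ) (m : ℝ) :
    Integrable (fun g => if m / 2 < N g then N g ^ 2 else 0) μ :=
  Integrable.mono' hN.integrable_sq (tau_aesm hN m) (Eventually.of_forall (tau_bd m))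

theorem tau_tendsto (hN : MemLp N 2 μ) : Tendsto (tau N μ) atTop (𝓝 0) := by
  have : Tendsto (tau N μ) atTop (𝓝 (∫ _g : G, (0:ℝ) ∂μ)) := by
    refine tendsto_integral_filter_of_dominated_convergence (fun g => N g ^ 2)
      (Eventually.of_forall (tau_aesm hN)) ?_ hN.integrable_sq ?_
    · exact Eventually.of_forall fun m => Eventually.of_forall (tau_bd m)
    · refine Eventually.of_forall fun g => ?_
      refine tendsto_const_nhds.congr' ?_
      filter_upwards [eventually_ge_atTop (2 * N g)] with m hm
      rw [if_neg (by linarith)]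
  simpa using this

namespace ScalCoc

theorem memLp_sub_clip (h : ScalCoc c N μ) (n : ℕ) (x : X) {m : ℝ} (hm : 0 ≤ m) :
    MemLp (fun g => c g x - clip m (c g x)) 2 (convPow μ n) :=
  MemLp.of_le (h.memLp n x)
    ((h.meas_left x).sub ((measurable_clip m).comp (h.meas_left x))).aestronglyMeasurable
    (Eventually.of_forall fun g => abs_sub_clip_le hm _)

theorem hh_int (h : ScalCoc c N μ) (n : ℕ) (x : X) {m : ℝ} (hm : 0 ≤ m) :
    Integrable (fun g => hh m (c g x)) (convPow μ n) :=
  (h.memLp_sub_clip n x hm).integrable_sq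

theorem hh_bound (h : ScalCoc c N μ) (n : ℕ) (x : X) {m : ℝ} (hm : 0 < m) :
    ∫ g, hh m (c g x) ∂convPow μ n
      ≤ n * (4 / m ^ 2 * ((∫ g, N g ^ 2 ∂μ) ^ 2) * n + tau N μ m) := by
  have hV : 0 ≤ ∫ g, N g ^ 2 ∂μ := integral_nonneg fun g => sq_nonneg _
  induction n with
  | zero =>
    change ∫ g, hh m (c g x) ∂(Measure.dirac 1) ≤ _
    rw [integral_dirac' (fun g => hh m (c g x)) _ ((measurable_hh m).comp (h.meas_left x)).stronglyMeasurable]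
    have := h.coc 1 1 x
    have h0 : c 1 x = 0 := by simpa using this
    have h1 := hh_eq_zero hm.le (s := 0) (by simpa using hm.le)
    simp [h0, hh, h1]
  | succ n ih =>
    have hsq := h.sq_le n x
    rw [Nat.add_comm, integral_convPow_add (f := fun g => hh m (c g x)) _ _
      ((measurable_hh m).comp (h.meas_left x))]
    have i1 : Integrable (fun p : G × G => hh m (c p.2 x))
      ((convPow μ 1).prod (convPow μ n)) := (h.hh_int n x hm.le).comp_snd _
    have hf : MemLp (fun g => 2 * (c g x - clip m (c g x))) 2 (convPow μ n) :=
      (h.memLp_sub_clip n x hm.le).const_mul 2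
    have i2 : Integrable (fun p : G × G => (2 * (c p.2 x - clip m (c p.2 x))) * c p.1 (p.2 • x))
      ((convPow μ 1).prod (convPow μ n)) := int_mul (hf.comp_snd _) (h.memLp_act 1 n x)
    have i3 : Integrable (fun p : G × G => N p.1 ^ 2 * (4 / m ^ 2 * (c p.2 x * c p.2 x)))
      ((convPow μ 1).prod (convPow μ n)) := by
      refine Integrable.mul_prod (f := fun g => N g ^ 2)
        (g := fun g => 4 / m ^ 2 * (c g x * c g x)) ?_ ?_
      · rw [convPow_one]; exact h.mem.integrable_sq
      · exact (int_mul (h.memLp n x) (h.memLp n x)).const_mul _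
    have i4 : Integrable (fun p : G × G => if m / 2 < N p.1 then N p.1 ^ 2 else 0)
      ((convPow μ 1).prod (convPow μ n)) := by
      rw [convPow_one]
      exact (tau_int h.mem m).comp_fst _
    have hle : ∫ p : G × G, hh m (c (p.1 * p.2) x) ∂((convPow μ 1).prod (convPow μ n))
        ≤ ∫ p : G × G, (hh m (c p.2 x) + (2 * (c p.2 x - clip m (c p.2 x))) * c p.1 (p.2 • x)
          + N p.1 ^ 2 * (4 / m ^ 2 * (c p.2 x * c p.2 x))
          + (if m / 2 < N p.1 then N p.1 ^ 2 else 0)) ∂((convPow μ 1).prod (convPow μ n)) := by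
      refine integral_mono_of_nonneg (Eventually.of_forall fun p => ?_)
        (((i1.add i2).add i3).add i4) (Eventually.of_forall fun p => ?_)
      · exact sq_nonneg _
      · change hh m (c (p.1 * p.2) x) ≤ _
        rw [h.coc]
        exact hh_step hm _ _ _ (h.bd _ _)
    rw [int_add4 i1 i2 i3 i4, h.cross_zero 1 n x hf,
      integral_fun_snd (fun g => hh m (c g x)),
      integral_fun_fst (fun g => if m / 2 < N g then N g ^ 2 else 0),
      integral_prod_mul (fun g => N g ^ 2) (fun g => 4 / m ^ 2 * (c g x * c g x)),
      integral_const_mul, convPow_one] at hle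
    simp only [probReal_univ, one_smul] at hle
    change _ ≤ _ + tau N μ m at hle
    have hm2 : 0 ≤ 4 / m ^ 2 := by positivity
    have h3 : (∫ g, N g ^ 2 ∂μ) * (4 / m ^ 2 * ∫ g, c g x * c g x ∂convPow μ n)
        ≤ (∫ g, N g ^ 2 ∂μ) * (4 / m ^ 2 * (n * ∫ g, N g ^ 2 ∂μ)) := by gcongr
    rw [convPow_one]
    push_cast
    have hn : (0:ℝ) ≤ n := Nat.cast_nonneg n
    have h4 : 0 ≤ 4 / m ^ 2 * ((∫ g, N g ^ 2 ∂μ) ^ 2) := by positivity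
    nlinarith

end ScalCoc

theorem hh_unif (hN : MemLp N 2 μ) (δ : ℝ) (hδ : 0 < δ) : ∃ a : ℝ, 0 < a ∧
    ∀ c : G → X → ℝ, ScalCoc c N μ → ∀ n : ℕ, 1 ≤ n → ∀ x,
      ∫ g, hh (√(a * n)) (c g x) ∂convPow μ n ≤ δ * n := by
  have h1 := (tau_tendsto hN).eventually (gt_mem_nhds (half_pos hδ))
  obtain ⟨M, hM⟩ := eventually_atTop.1 h1
  set V := ∫ g, N g ^ 2 ∂μ with hV
  refine ⟨8 * V ^ 2 / δ + M ^ 2 + 1, by positivity, fun c h n hn x => ?_⟩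
  set a := 8 * V ^ 2 / δ + M ^ 2 + 1 with ha
  have ha0 : 0 < a := by positivity
  have hn1 : (1:ℝ) ≤ n := by exact_mod_cast hn
  have hp : 0 < a * n := by positivity
  refine (h.hh_bound n x (Real.sqrt_pos.2 hp)).trans ?_
  rw [Real.sq_sqrt hp.le, ← hV]
  have ht : tau N μ (√(a * n)) < δ / 2 := by
    apply hM
    apply Real.le_sqrt_of_sq_le
    have : 0 ≤ 8 * V ^ 2 / δ := by positivity
    nlinarith
  have h2 : 4 / (a * n) * V ^ 2 * n = 4 * V ^ 2 / a := by field_simp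
  have h3 : 4 * V ^ 2 / a ≤ δ / 2 := by
    rw [div_le_iff₀ ha0, ha]
    have : δ * (8 * V ^ 2 / δ) = 8 * V ^ 2 := by field_simp
    nlinarith [sq_nonneg M]
  rw [h2, mul_comm]
  gcongr
  linarith

theorem cov_osc {c c' : G → X → ℝ} (h : ScalCoc c N μ) (h' : ScalCoc c' N μ)
    (hctrl : ∀ ε > (0 : ℝ), ∃ R > (0 : ℝ), ∀ n : ℕ, 1 ≤ n → ∀ x y : X,
      ENNReal.ofReal (1 - ε) ≤ convPow μ n {g | |c g x - c g y| ≤ R ∧ |c' g x - c' g y| ≤ R})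
    (ε : ℝ) (hε : 0 < ε) : ∃ n₀ : ℕ, 1 ≤ n₀ ∧ ∀ n ≥ n₀, ∀ x y : X,
      |∫ g, c g x * c' g x ∂convPow μ n - ∫ g, c g y * c' g y ∂convPow μ n| ≤ ε * n := by
  set V := ∫ g, N g ^ 2 ∂μ with hV
  have hV0 : 0 ≤ V := integral_nonneg fun g => sq_nonneg _
  obtain ⟨a, ha, hua⟩ := hh_unif (X := X) h.mem (ε / 16) (by positivity)
  obtain ⟨R, hR, hc⟩ := hctrl (ε / (16 * a)) (by positivity)
  set κ := ε / (8 * (V + 1)) with hκ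
  have hκ0 : 0 < κ := by positivity
  obtain ⟨n₁, hn₁⟩ := exists_nat_ge (R ^ 2 / (2 * κ) * 4 / ε)
  refine ⟨n₁ + 1, by omega, fun n hn x y => ?_⟩
  have hn1 : 1 ≤ n := by omega
  have hnr : (1:ℝ) ≤ n := by exact_mod_cast hn1
  set m := √(a * n) with hm
  have hm0 : 0 ≤ m := Real.sqrt_nonneg _
  have hm2 : m ^ 2 = a * n := Real.sq_sqrt (by positivity)
  set B := {g | |c g x - c g y| ≤ R ∧ |c' g x - c' g y| ≤ R} with hB
  have hBm : MeasurableSet B :=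
    (measurableSet_le ((h.meas_left x).sub (h.meas_left y)).norm measurable_const).inter
      (measurableSet_le ((h'.meas_left x).sub (h'.meas_left y)).norm measurable_const)
  have hBp : (convPow μ n).real Bᶜ ≤ ε / (16 * a) := by
    have := (ENNReal.ofReal_le_iff_le_toReal (measure_ne_top _ _)).1 (hc n hn1 x y)
    rw [probReal_compl_eq_one_sub hBm]
    change _ ≤ (convPow μ n).real B at this
    linarith
  have hIB : Integrable (Bᶜ.indicator fun _ => (1:ℝ)) (convPow μ n) ∧
      ∫ g, Bᶜ.indicator (fun _ => (1:ℝ)) g ∂convPow μ n ≤ ε / (16 * a) := by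
    refine ⟨(integrable_const _).indicator hBm.compl, ?_⟩
    rw [integral_indicator_const _ hBm.compl]
    simpa using hBp
  have hS : ∀ {c : G → X → ℝ}, ScalCoc c N μ → ∀ x,
      Integrable (fun g => c g x * c g x) (convPow μ n) ∧
      ∫ g, c g x * c g x ∂convPow μ n ≤ n * V := fun h x =>
    ⟨int_mul (h.memLp n x) (h.memLp n x), h.sq_le n x⟩
  have hH : ∀ {c : G → X → ℝ}, ScalCoc c N μ → ∀ x,
      Integrable (fun g => hh m (c g x)) (convPow μ n) ∧
      ∫ g, hh m (c g x) ∂convPow μ n ≤ ε / 16 * n := fun h x =>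
    ⟨h.hh_int n x hm0, hua _ h n hn1 x⟩
  have hK : Integrable (fun _ : G => R ^ 2 / (2 * κ)) (convPow μ n) ∧
      ∫ _g, R ^ 2 / (2 * κ) ∂convPow μ n ≤ R ^ 2 / (2 * κ) := ⟨integrable_const _, by simp⟩
  have hT := ib_add (ib_add (ib_add (ib_mul hκ0.le (ib_add (hS h' x) (hS h y))) hK)
    (ib_add (ib_add (hH h x) (hH h' x)) (ib_add (hH h y) (hH h' y))))
    (ib_mul (show 0 ≤ 4 * m ^ 2 by positivity) hIB)
  rw [← integral_sub (int_mul (h.memLp n x) (h'.memLp n x))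
    (int_mul (h.memLp n y) (h'.memLp n y))]
  refine (abs_integral_le_integral_abs).trans ((integral_mono_of_nonneg
    (Eventually.of_forall fun g => abs_nonneg _) hT.1
    (Eventually.of_forall fun g => ?_)).trans (hT.2.trans ?_))
  · have p1 : ∀ s, 0 ≤ hh m s := fun s => sq_nonneg _
    have q1 := p1 (c g x)
    have q2 := p1 (c' g x)
    have q3 := p1 (c g y)
    have q4 := p1 (c' g y)
    change |c g x * c' g x - c g y * c' g y| ≤ κ * (c' g x * c' g x + c g y * c g y)
      + R ^ 2 / (2 * κ) + (hh m (c g x) + hh m (c' g x) + (hh m (c g y) + hh m (c' g y)))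
      + 4 * m ^ 2 * Bᶜ.indicator (fun _ => (1:ℝ)) g
    by_cases hg : g ∈ B
    · rw [Set.indicator_of_notMem (by simpa using hg)]
      have key : ∀ s : ℝ, R * |s| ≤ κ * (s * s) + R ^ 2 / (4 * κ) := by
        intro s
        have e : κ * (s * s) + R ^ 2 / (4 * κ) - R * |s| = (2 * κ * |s| - R) ^ 2 / (4 * κ) := by
          rw [← abs_mul_abs_self s]; field_simp; ring
        have : 0 ≤ (2 * κ * |s| - R) ^ 2 / (4 * κ) := by positivity
        linarith
      have e2 : R ^ 2 / (2 * κ) = R ^ 2 / (4 * κ) + R ^ 2 / (4 * κ) := by field_simp; ring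
      have e3 : c g x * c' g x - c g y * c' g y
        = (c g x - c g y) * c' g x + (c' g x - c' g y) * c g y := by ring
      have e4 : |c g x * c' g x - c g y * c' g y| ≤ R * |c' g x| + R * |c g y| := by
        rw [e3]
        refine (abs_add_le _ _).trans ?_
        rw [abs_mul, abs_mul]
        gcongr
        · exact hg.1
        · exact hg.2
      have k1 := key (c' g x)
      have k2 := key (c g y)
      linarith
    · rw [Set.indicator_of_mem (by simpa using hg)]
      have r1 := sq_le_hh hm0 (c g x)
      have r2 := sq_le_hh hm0 (c' g x)
      have r3 := sq_le_hh hm0 (c g y)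
      have r4 := sq_le_hh hm0 (c' g y)
      have z1 : 0 ≤ κ * (c' g x * c' g x + c g y * c g y) :=
        mul_nonneg hκ0.le (add_nonneg (mul_self_nonneg _) (mul_self_nonneg _))
      have z2 : 0 ≤ R ^ 2 / (2 * κ) := by positivity
      have : |c g x * c' g x - c g y * c' g y| ≤ 1 / 2 * (c g x * c g x + c' g x * c' g x
          + (c g y * c g y + c' g y * c' g y)) := by
        rw [abs_le]
        constructor <;> nlinarith [sq_nonneg (c g x + c' g x), sq_nonneg (c g x - c' g x),
          sq_nonneg (c g y + c' g y), sq_nonneg (c g y - c' g y)]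
      linarith
  · rw [hm2]
    have f1 : κ * (n * V + n * V) ≤ ε / 4 * n := by
      have : κ * (V + 1) = ε / 8 := by rw [hκ]; field_simp
      nlinarith
    have f2 : R ^ 2 / (2 * κ) ≤ ε / 4 * n := by
      have hn₂ : R ^ 2 / (2 * κ) * 4 / ε ≤ n :=
        hn₁.trans (by exact_mod_cast (by omega : n₁ ≤ n))
      rw [div_le_iff₀ hε] at hn₂
      linarith
    have f3 : 4 * (a * n) * (ε / (16 * a)) = ε / 4 * n := by field_simp; ring
    linarith

theorem cov_lim [Nonempty X] {c c' : G → X → ℝ} (h : ScalCoc c N μ) (h' : ScalCoc c' N μ)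
    (hctrl : ∀ ε > (0 : ℝ), ∃ R > (0 : ℝ), ∀ n : ℕ, 1 ≤ n → ∀ x y : X,
      ENNReal.ofReal (1 - ε) ≤ convPow μ n {g | |c g x - c g y| ≤ R ∧ |c' g x - c' g y| ≤ R}) :
    ∃ a : ℝ, ∀ ε > (0 : ℝ), ∃ n₀ : ℕ, ∀ n ≥ n₀, ∀ x : X,
      |(n : ℝ)⁻¹ * (∫ g, c g x * c' g x ∂convPow μ n) - a| < ε := by
  set V := ∫ g, N g ^ 2 ∂μ with hV
  have hV0 : 0 ≤ V := integral_nonneg fun g => sq_nonneg _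
  have hbd : ∀ n, BddAbove (Set.range fun x : X => ∫ g, c g x * c' g x ∂convPow μ n) := by
    intro n
    refine ⟨n * V, ?_⟩
    rintro _ ⟨x, rfl⟩
    exact (abs_le.1 (h.cov_le h' n x)).2
  set s : ℕ → ℝ := fun n => ⨆ x : X, ∫ g, c g x * c' g x ∂convPow μ n with hs
  have hle : ∀ n x, ∫ g, c g x * c' g x ∂convPow μ n ≤ s n := fun n x => le_ciSup (hbd n) x
  have hsub : Subadditive s := by
    intro m n
    refine ciSup_le fun x => ?_
    rw [h.cov_add h' m n x, add_comm]
    refine add_le_add ?_ (hle n x)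
    calc _ ≤ ∫ _g, s m ∂convPow μ n :=
          integral_mono (h.cov_int h' m n x) (integrable_const _) fun g => hle m _
      _ = s m := by simp
  have hbelow : BddBelow (Set.range fun n => s n / n) := by
    refine ⟨-V, ?_⟩
    rintro _ ⟨n, rfl⟩
    rcases Nat.eq_zero_or_pos n with rfl | hn
    · simpa using hV0
    · have hn' : (0:ℝ) < n := by exact_mod_cast hn
      change -V ≤ s n / n
      rw [le_div_iff₀ hn']
      have x : X := Classical.arbitrary X
      have h1 := (abs_le.1 (h.cov_le h' n x)).1
      have h2 := hle n x
      rw [← hV] at h1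
      linarith
  have hlim := hsub.tendsto_lim hbelow
  refine ⟨hsub.lim, fun ε hε => ?_⟩
  obtain ⟨n₁, hn₁1, hn₁⟩ := cov_osc h h' hctrl (ε / 2) (by positivity)
  obtain ⟨n₂, hn₂⟩ := Metric.tendsto_atTop.1 hlim (ε / 2) (by positivity)
  refine ⟨max n₁ n₂, fun n hn x => ?_⟩
  have hn0 : (0:ℝ) < n := by
    have : 1 ≤ n := hn₁1.trans ((le_max_left _ _).trans hn)
    exact_mod_cast this
  have a1 := hn₂ n ((le_max_right _ _).trans hn)
  rw [Real.dist_eq] at a1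
  have a2 : s n ≤ ∫ g, c g x * c' g x ∂convPow μ n + ε / 2 * n := by
    refine ciSup_le fun y => ?_
    have := (abs_le.1 (hn₁ n ((le_max_left _ _).trans hn) y x)).2
    linarith
  have a3 := hle n x
  have a4 : |(n : ℝ)⁻¹ * (∫ g, c g x * c' g x ∂convPow μ n) - s n / n| ≤ ε / 2 := by
    rw [inv_mul_eq_div, ← sub_div, abs_div, abs_of_pos hn0, div_le_iff₀ hn0, abs_le]
    constructor <;> nlinarith
  calc _ ≤ |(n : ℝ)⁻¹ * (∫ g, c g x * c' g x ∂convPow μ n) - s n / n| + |s n / n - hsub.lim| :=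
        abs_sub_le _ _ _
    _ < ε := by linarith

end aux

/-- existence of the limit covariance matrix, uniformly in `x`. -/
theorem covariance_limit
    {G : Type*} [Group G] [MeasurableSpace G] [MeasurableMul₂ G]
    {X : Type*} [MetricSpace X] [CompactSpace X] [MeasurableSpace X] [BorelSpace X]
    [MulAction G X] (hact : Measurable fun p : G × X => p.1 • p.2)
    {d : ℕ} (σ : G → X → EuclideanSpace ℝ (Fin d))
    (hσmeas : Measurable fun p : G × X => σ p.1 p.2)
    (hcoc : ∀ g₁ g₂ : G, ∀ x : X, σ (g₂ * g₁) x = σ g₂ (g₁ • x) + σ g₁ x)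
    (N : G → ℝ) (hN0 : ∀ g, 0 ≤ N g) (hNsub : ∀ g h : G, N (g * h) ≤ N g + N h)
    (hNσ : ∀ g x, ‖σ g x‖ ≤ N g)
    (μ : Measure G) [IsProbabilityMeasure μ]
    (hmom1 : Integrable N μ)
    (hdrift : ∀ x, ∫ g, σ g x ∂μ = 0)
    (hmom2 : Integrable (fun g => N g ^ 2) μ)
    (hcont : ∀ g, Continuous (σ g))
    (hXctrl : ∀ ε > (0 : ℝ), ∃ R > (0 : ℝ), ∀ n : ℕ, 1 ≤ n → ∀ x y : X,
      ENNReal.ofReal (1 - ε) ≤ convPow μ n {g | ‖σ g x - σ g y‖ ≤ R}) :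
    ∃ A : Matrix (Fin d) (Fin d) ℝ, A.PosSemidef ∧
      ∀ ε > (0 : ℝ), ∃ n₀ : ℕ, ∀ n ≥ n₀, ∀ x : X, ∀ i j : Fin d,
        |(n : ℝ)⁻¹ * (∫ g, σ g x i * σ g x j ∂convPow μ n) - A i j| < ε := by
  have hsc : ∀ i, ScalCoc (fun g x => σ g x i) N μ := by
    intro i
    have hp : ∀ v : EuclideanSpace ℝ (Fin d), |v i| ≤ ‖v‖ := fun v => by
      simpa using PiLp.norm_apply_le v i
    refine ⟨hact, ?_, ?_, ?_, ?_, ?_⟩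
    · exact (EuclideanSpace.proj (𝕜 := ℝ) i).continuous.measurable.comp hσmeas
    · intro g₁ g₂ x
      simp [hcoc]
    · exact fun g x => (hp _).trans (hNσ g x)
    · exact (memLp_two_iff_integrable_sq hmom1.1).2 hmom2
    · intro x
      have hm : Measurable fun g => σ g x := hσmeas.comp (measurable_id.prodMk measurable_const)
      have hi : Integrable (fun g => σ g x) μ :=
        Integrable.mono' hmom1 hm.aestronglyMeasurable (Eventually.of_forall fun g => hNσ g x)
      have := (EuclideanSpace.proj (𝕜 := ℝ) i).integral_comp_comm hi
      rw [hdrift x] at this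
      simpa using this
  rcases isEmpty_or_nonempty X with hX | hX
  · exact ⟨0, Matrix.PosSemidef.zero, fun ε _ => ⟨0, fun n _ x => (hX.false x).elim⟩⟩
  have hctrl : ∀ i j : Fin d, ∀ ε > (0 : ℝ), ∃ R > (0 : ℝ), ∀ n : ℕ, 1 ≤ n → ∀ x y : X,
      ENNReal.ofReal (1 - ε) ≤
        convPow μ n {g | |σ g x i - σ g y i| ≤ R ∧ |σ g x j - σ g y j| ≤ R} := by
    intro i j ε hε
    obtain ⟨R, hR, hc⟩ := hXctrl ε hε
    refine ⟨R, hR, fun n hn x y => (hc n hn x y).trans (measure_mono fun g hg => ?_)⟩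
    have hp : ∀ k, |σ g x k - σ g y k| ≤ ‖σ g x - σ g y‖ := fun k => by
      simpa using PiLp.norm_apply_le (σ g x - σ g y) k
    exact ⟨(hp i).trans hg, (hp j).trans hg⟩
  have hA := fun i j => cov_lim (hsc i) (hsc j) (hctrl i j)
  choose A hA using hA
  obtain ⟨x₀⟩ := hX
  have hT : ∀ i j, Tendsto (fun n : ℕ => (n : ℝ)⁻¹ * (∫ g, σ g x₀ i * σ g x₀ j ∂convPow μ n))
      atTop (𝓝 (A i j)) := by
    intro i j
    rw [Metric.tendsto_atTop]
    intro ε hε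
    obtain ⟨n₀, h⟩ := hA i j ε hε
    exact ⟨n₀, fun n hn => by rw [Real.dist_eq]; exact h n hn x₀⟩
  refine ⟨Matrix.of A, ?_, ?_⟩
  · rw [Matrix.posSemidef_iff_dotProduct_mulVec]
    constructor
    · ext i j
      simp only [Matrix.conjTranspose_apply, Matrix.of_apply, star_trivial]
      refine tendsto_nhds_unique (hT j i) ?_
      simp_rw [mul_comm (σ _ x₀ j)]
      exact hT i j
    · intro v
      have hq : Tendsto (fun n : ℕ => ∑ i, v i * ∑ j,
          ((n : ℝ)⁻¹ * (∫ g, σ g x₀ i * σ g x₀ j ∂convPow μ n)) * v j) atTop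
          (𝓝 (∑ i, v i * ∑ j, A i j * v j)) :=
        tendsto_finset_sum _ fun i _ => (tendsto_finset_sum _ fun j _ =>
          (hT i j).mul_const _).const_mul _
      change 0 ≤ ∑ i, v i * ∑ j, A i j * v j
      refine ge_of_tendsto' hq fun n => ?_
      have hintg : ∀ i j, Integrable (fun g => σ g x₀ i * σ g x₀ j) (convPow μ n) := fun i j =>
        int_mul ((hsc i).memLp n x₀) ((hsc j).memLp n x₀)
      have e : ∑ i, v i * ∑ j, ((n : ℝ)⁻¹ * (∫ g, σ g x₀ i * σ g x₀ j ∂convPow μ n)) * v j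
          = (n : ℝ)⁻¹ * ∫ g, (∑ i, v i * σ g x₀ i) ^ 2 ∂convPow μ n := by
        have e1 : ∀ g, (∑ i, v i * σ g x₀ i) ^ 2
            = ∑ i, ∑ j, (v i * v j) * (σ g x₀ i * σ g x₀ j) := by
          intro g
          rw [sq, Finset.sum_mul_sum]
          refine Finset.sum_congr rfl fun i _ => Finset.sum_congr rfl fun j _ => by ring
        simp_rw [e1]
        rw [integral_finset_sum _ fun i _ => integrable_finset_sum _ fun j _ =>
          (hintg i j).const_mul _, Finset.mul_sum]
        refine Finset.sum_congr rfl fun i _ => ?_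
        rw [integral_finset_sum _ fun j _ => (hintg i j).const_mul _, Finset.mul_sum,
          Finset.mul_sum]
        refine Finset.sum_congr rfl fun j _ => ?_
        rw [integral_const_mul]
        ring
      rw [e]
      exact mul_nonneg (by positivity) (integral_nonneg fun g => sq_nonneg _)
  · intro ε hε
    choose f hf using fun i j => hA i j ε hε
    refine ⟨∑ i, ∑ j, f i j, fun n hn x i j => hf i j n ?_ x⟩
    refine le_trans ?_ hn
    exact (Finset.single_le_sum (f := fun j => f i j) (fun _ _ => Nat.zero_le _)
      (Finset.mem_univ j)).trans (Finset.single_le_sum (f := fun i => ∑ j, f i j)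
      (fun _ _ => Nat.zero_le _) (Finset.mem_univ i))
end
end

section
/- Assume μ has finite second moment and σ is X-controlled, and let A be the limit covariance matrix, i.e. the positive semidefinite symmetric matrix such that (1/n) ∫_G σ(g,x) σ(g,x)ᵀ dμ^{*n}(g) → A uniformly in x. Then σ has unique covariance: for every n ≥ 1 and every μ-stationary Borel probability measure ν on X, A = (1/n) ∫_{G×X} σ(g,x) σ(g,x)ᵀ dμ^{*n}(g) dν(x). -/
open MeasureTheory Filter Topology
open scoped ENNReal NNReal

noncomputable section

/-- The σ-algebra on `ℕ → G` generated by the first `k` coordinates. -/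
def coordSA (G : Type*) [MeasurableSpace G] (k : ℕ) : MeasurableSpace (ℕ → G) :=
  MeasurableSpace.comap (fun b (i : Fin k) => b i) MeasurableSpace.pi

theorem isProb_convPow {G : Type*} [Monoid G] [MeasurableSpace G] [MeasurableMul₂ G]
    (μ : Measure G) [IsProbabilityMeasure μ] (n : ℕ) : IsProbabilityMeasure (convPow μ n) := by
  induction n with
  | zero => simp only [convPow]; infer_instance
  | succ n ih =>
    simp only [convPow]
    exact Measure.isProbabilityMeasure_map (measurable_fst.mul measurable_snd).aemeasurable

theorem mp_conv {G : Type*} [Group G] [MeasurableSpace G] [MeasurableMul₂ G]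
    {X : Type*} [MeasurableSpace X] (μ : Measure G) [IsProbabilityMeasure μ]
    (ν : Measure X) [IsProbabilityMeasure ν] (n : ℕ) :
    MeasurePreserving (fun q : G × (G × X) => (q.1 * q.2.1, q.2.2))
      (μ.prod ((convPow μ n).prod ν)) ((convPow μ (n+1)).prod ν) := by
  have := isProb_convPow μ n
  have := isProb_convPow μ (n+1)
  have h1 : MeasurePreserving (fun p : G × G => p.1 * p.2) (μ.prod (convPow μ n))
      (convPow μ (n+1)) := ⟨measurable_fst.mul measurable_snd, rfl⟩
  have h2 := h1.prod (MeasurePreserving.id ν)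
  have h3 := (measurePreserving_prodAssoc μ (convPow μ n) ν).symm
  exact h2.comp h3

theorem mp_act {G : Type*} [Group G] [MeasurableSpace G] [MeasurableMul₂ G]
    {X : Type*} [MetricSpace X] [MeasurableSpace X] [BorelSpace X]
    [MulAction G X] (hact : Measurable fun p : G × X => p.1 • p.2)
    (μ : Measure G) [IsProbabilityMeasure μ]
    (ν : Measure X) [IsProbabilityMeasure ν]
    (hstat : ∀ f : BoundedContinuousFunction X ℝ,
      ∫ g, (∫ x, f (g • x) ∂ν) ∂μ = ∫ x, f x ∂ν) (n : ℕ) :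
    MeasurePreserving (fun p : G × X => p.1 • p.2) ((convPow μ n).prod ν) ν := by
  have h1 : MeasurePreserving (fun p : G × X => p.1 • p.2) (μ.prod ν) ν := by
    refine ⟨hact, ?_⟩
    have : IsProbabilityMeasure ((μ.prod ν).map fun p : G × X => p.1 • p.2) :=
      Measure.isProbabilityMeasure_map hact.aemeasurable
    refine ext_of_forall_integral_eq_of_IsFiniteMeasure fun f => ?_
    have hf : Measurable f := f.continuous.measurable
    rw [integral_map hact.aemeasurable hf.aestronglyMeasurable, integral_prod, hstat f]
    refine Integrable.of_bound (hf.comp hact).aestronglyMeasurable ‖f‖ ?_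
    exact Eventually.of_forall fun p => f.norm_coe_le_norm _
  induction n with
  | zero =>
    refine ⟨hact, ?_⟩
    simp only [convPow]
    rw [Measure.dirac_prod, Measure.map_map hact (by fun_prop)]
    have : (fun p : G × X => p.1 • p.2) ∘ (Prod.mk (1:G)) = id := by
      ext x; simp
    rw [this, Measure.map_id]
  | succ n ih =>
    have := isProb_convPow μ n
    refine ⟨hact, ?_⟩
    have hc := mp_conv μ ν n
    rw [← hc.map_eq, Measure.map_map hact hc.measurable]
    have h2 := h1.comp ((MeasurePreserving.id μ).prod ih)
    have e : (fun p : G × X => p.1 • p.2) ∘ (fun q : G × (G × X) => (q.1 * q.2.1, q.2.2))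
        = (fun p : G × X => p.1 • p.2) ∘ (Prod.map id (fun p : G × X => p.1 • p.2)) := by
      ext q; simp [mul_smul]
    rw [e]
    exact h2.map_eq

/-- the cocycle has unique covariance. -/
theorem unique_covariance
    {G : Type*} [Group G] [MeasurableSpace G] [MeasurableMul₂ G]
    {X : Type*} [MetricSpace X] [CompactSpace X] [MeasurableSpace X] [BorelSpace X]
    [MulAction G X] (hact : Measurable fun p : G × X => p.1 • p.2)
    {d : ℕ} (σ : G → X → EuclideanSpace ℝ (Fin d))
    (hσmeas : Measurable fun p : G × X => σ p.1 p.2)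
    (hcoc : ∀ g₁ g₂ : G, ∀ x : X, σ (g₂ * g₁) x = σ g₂ (g₁ • x) + σ g₁ x)
    (N : G → ℝ) (hN0 : ∀ g, 0 ≤ N g) (hNsub : ∀ g h : G, N (g * h) ≤ N g + N h)
    (hNσ : ∀ g x, ‖σ g x‖ ≤ N g)
    (μ : Measure G) [IsProbabilityMeasure μ]
    (hmom1 : Integrable N μ)
    (hdrift : ∀ x, ∫ g, σ g x ∂μ = 0)
    (hmom2 : Integrable (fun g => N g ^ 2) μ)
    (hcont : ∀ g, Continuous (σ g))
    (hXctrl : ∀ ε > (0 : ℝ), ∃ R > (0 : ℝ), ∀ n : ℕ, 1 ≤ n → ∀ x y : X,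
      ENNReal.ofReal (1 - ε) ≤ convPow μ n {g | ‖σ g x - σ g y‖ ≤ R})
    (A : Matrix (Fin d) (Fin d) ℝ) (hApsd : A.PosSemidef)
    (hA : ∀ ε > (0 : ℝ), ∃ n₀ : ℕ, ∀ n ≥ n₀, ∀ x : X, ∀ i j : Fin d,
      |(n : ℝ)⁻¹ * (∫ g, σ g x i * σ g x j ∂convPow μ n) - A i j| < ε)
    (ν : Measure X) [IsProbabilityMeasure ν]
    (hstat : ∀ f : BoundedContinuousFunction X ℝ,
      ∫ g, (∫ x, f (g • x) ∂ν) ∂μ = ∫ x, f x ∂ν) :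
    ∀ n : ℕ, 1 ≤ n → ∀ i j : Fin d,
      A i j = (n : ℝ)⁻¹ *
        ∫ p : G × X, σ p.1 p.2 i * σ p.1 p.2 j ∂((convPow μ n).prod ν) := by
  have hu : ∀ i, Measurable fun p : G × X => σ p.1 p.2 i := fun i => by
    exact (EuclideanSpace.proj (𝕜 := ℝ) i).continuous.measurable.comp hσmeas
  have huv : ∀ i j, Measurable fun p : G × X => σ p.1 p.2 i * σ p.1 p.2 j := fun i j =>
    (hu i).mul (hu j)
  have hle : ∀ g x i, ‖σ g x i‖ ≤ N g := fun g x i =>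
    (PiLp.norm_apply_le (σ g x) i).trans (hNσ g x)
  have hNL : MemLp N 2 μ := (memLp_two_iff_integrable_sq hmom1.aestronglyMeasurable).2 hmom2
  have hL1 : ∀ i, MemLp (fun p : G × X => σ p.1 p.2 i) 2 (μ.prod ν) := fun i => by
    have h : MemLp (fun p : G × X => N p.1) 2 (μ.prod ν) :=
      hNL.comp_measurePreserving measurePreserving_fst
    refine h.mono (hu i).aestronglyMeasurable (Eventually.of_forall fun p => ?_)
    exact (hle p.1 p.2 i).trans (le_abs_self _)
  have hprob := fun n => isProb_convPow μ n
  have hT : ∀ n, MeasurePreserving (fun q : G × (G × X) => (q.1, q.2.1 • q.2.2))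
      (μ.prod ((convPow μ n).prod ν)) (μ.prod ν) := fun n =>
    (MeasurePreserving.id μ).prod (mp_act hact μ ν hstat n)
  have ha : ∀ n i, MemLp (fun q : G × (G × X) => σ q.1 (q.2.1 • q.2.2) i) 2
      (μ.prod ((convPow μ n).prod ν)) := fun n i =>
    (hL1 i).comp_measurePreserving (hT n)
  have hb' : ∀ n i, MemLp (fun p : G × X => σ p.1 p.2 i) 2 ((convPow μ n).prod ν) →
      MemLp (fun q : G × (G × X) => σ q.2.1 q.2.2 i) 2
      (μ.prod ((convPow μ n).prod ν)) := fun n i h =>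
    h.comp_measurePreserving measurePreserving_snd
  have hσ1 : ∀ x, σ 1 x = 0 := fun x => by
    have := hcoc 1 1 x
    simpa using this
  have hL : ∀ n i, MemLp (fun p : G × X => σ p.1 p.2 i) 2 ((convPow μ n).prod ν) := by
    intro n i
    induction n with
    | zero =>
      simp only [convPow]
      rw [Measure.dirac_prod]
      rw [memLp_map_measure_iff (hu i).aestronglyMeasurable (by fun_prop)]
      have : (fun p : G × X => σ p.1 p.2 i) ∘ (Prod.mk (1:G)) = fun _ => 0 := by
        ext x; simp [hσ1]
      rw [this]
      exact MemLp.zero'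
    | succ n ih =>
      have hc := mp_conv μ ν n
      rw [← hc.map_eq, memLp_map_measure_iff (hu i).aestronglyMeasurable
        hc.measurable.aemeasurable]
      refine ((ha n i).add (hb' n i ih)).congr_norm ?_ (Eventually.of_forall fun q => ?_)
      · exact ((hu i).comp hc.measurable).aestronglyMeasurable
      · simp [hcoc]
  have hb := fun n i => hb' n i (hL n i)
  have hcross : ∀ n i j, ∫ q : G × (G × X), σ q.1 (q.2.1 • q.2.2) i * σ q.2.1 q.2.2 j
      ∂(μ.prod ((convPow μ n).prod ν)) = 0 := by
    intro n i j
    have hi : Integrable (fun q : G × (G × X) => σ q.1 (q.2.1 • q.2.2) i * σ q.2.1 q.2.2 j)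
      (μ.prod ((convPow μ n).prod ν)) := (ha n i).integrable_mul (hb n j)
    rw [integral_prod_symm _ hi]
    refine integral_eq_zero_of_ae (Eventually.of_forall fun q => ?_)
    simp only [Pi.zero_apply]
    rw [integral_mul_const]
    have hint : Integrable (fun g => σ g (q.1 • q.2)) μ := by
      refine hmom1.mono' ?_ (Eventually.of_forall fun g => hNσ g _)
      exact (hσmeas.comp measurable_prodMk_right).aestronglyMeasurable
    have h0 := (EuclideanSpace.proj (𝕜 := ℝ) i).integral_comp_comm hint
    rw [hdrift] at h0
    have h1 : ∫ g, σ g (q.1 • q.2) i ∂μ = 0 := by simpa using h0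
    rw [h1, zero_mul]
  intro n₁ hn₁ i j
  set S : ℕ → ℝ := fun n => ∫ p : G × X, σ p.1 p.2 i * σ p.1 p.2 j ∂((convPow μ n).prod ν)
    with hS
  set C : ℝ := ∫ p : G × X, σ p.1 p.2 i * σ p.1 p.2 j ∂(μ.prod ν) with hC
  have hsucc : ∀ n, S (n+1) = C + S n := by
    intro n
    have hc := mp_conv μ ν n
    have e1 : S (n+1) = ∫ q : G × (G × X), (σ q.1 (q.2.1 • q.2.2) i * σ q.1 (q.2.1 • q.2.2) j
        + σ q.2.1 q.2.2 i * σ q.2.1 q.2.2 j) + (σ q.1 (q.2.1 • q.2.2) i * σ q.2.1 q.2.2 j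
        + σ q.1 (q.2.1 • q.2.2) j * σ q.2.1 q.2.2 i) ∂(μ.prod ((convPow μ n).prod ν)) := by
      simp only [hS]
      rw [← hc.map_eq, integral_map hc.measurable.aemeasurable
        (huv i j).aestronglyMeasurable]
      refine integral_congr_ae (Eventually.of_forall fun q => ?_)
      simp only [hcoc, PiLp.add_apply]
      ring
    have i1 := (ha n i).integrable_mul (ha n j)
    have i2 := (hb n i).integrable_mul (hb n j)
    have i3 := (ha n i).integrable_mul (hb n j)
    have i4 := (ha n j).integrable_mul (hb n i)
    have e2 : ∫ q : G × (G × X), σ q.1 (q.2.1 • q.2.2) i * σ q.1 (q.2.1 • q.2.2) j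
        ∂(μ.prod ((convPow μ n).prod ν)) = C := by
      rw [hC, ← (hT n).map_eq, integral_map (hT n).measurable.aemeasurable
        (huv i j).aestronglyMeasurable]
    have e3 : ∫ q : G × (G × X), σ q.2.1 q.2.2 i * σ q.2.1 q.2.2 j
        ∂(μ.prod ((convPow μ n).prod ν)) = S n := by
      have := integral_fun_snd (μ := μ) (ν := (convPow μ n).prod ν)
        (fun p : G × X => σ p.1 p.2 i * σ p.1 p.2 j)
      simpa using this
    rw [e1]
    erw [integral_add (i1.add i2) (i3.add i4), integral_add i1 i2, integral_add i3 i4]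
    erw [e2, e3, hcross n i j, hcross n j i]
    ring
  have hS0 : S 0 = 0 := by
    simp only [hS, convPow]
    rw [Measure.dirac_prod, integral_map (by fun_prop)
      (huv i j).aestronglyMeasurable]
    simp [hσ1]
  have hSn : ∀ n : ℕ, S n = n * C := by
    intro n
    induction n with
    | zero => simp [hS0]
    | succ n ih => rw [hsucc, ih]; push_cast; ring
  have hnC : ∀ n : ℕ, 1 ≤ n → (n : ℝ)⁻¹ * S n = C := by
    intro n hn
    have : (n : ℝ) ≠ 0 := by positivity
    rw [hSn]; field_simp
  change A i j = (n₁ : ℝ)⁻¹ * S n₁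
  rw [hnC n₁ hn₁]
  have key : ∀ ε > (0:ℝ), |C - A i j| ≤ ε := by
    intro ε hε
    obtain ⟨n₀, hn₀⟩ := hA ε hε
    have hm := hn₀ (n₀ + 1) (by omega)
    have hint := (hL (n₀+1) i).integrable_mul (hL (n₀+1) j)
    have hI : Integrable (fun x => ∫ g, σ g x i * σ g x j ∂convPow μ (n₀+1)) ν :=
      hint.integral_prod_right
    have e : C - A i j = ∫ x, (((n₀ + 1 : ℕ) : ℝ)⁻¹ *
        (∫ g, σ g x i * σ g x j ∂convPow μ (n₀+1)) - A i j) ∂ν := by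
      rw [integral_sub (hI.const_mul _) (integrable_const _), integral_const_mul,
        ← hnC (n₀+1) (by omega)]
      simp only [hS]
      erw [integral_prod_symm _ hint]
      simp
    rw [e]
    have := norm_integral_le_of_norm_le_const (μ := ν) (C := ε)
      (f := fun x => ((n₀ + 1 : ℕ) : ℝ)⁻¹ *
        (∫ g, σ g x i * σ g x j ∂convPow μ (n₀+1)) - A i j)
      (Eventually.of_forall fun x => (hm x i j).le)
    rw [← Real.norm_eq_abs]
    simpa only [probReal_univ, mul_one] using this
  have h0 : |C - A i j| ≤ 0 := le_of_forall_pos_le_add fun ε hε => by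
    simpa using key ε hε
  have := abs_nonpos_iff.1 h0
  linarith
end
end

section
/- Assume μ has finite exponential moment, i.e. ∫_G e^{α|g|} dμ(g) < ∞ for some α > 0. Then for every ε > 0 there exist constants D, δ > 0 such that for every n ≥ 1 and every x ∈ X, β{b ∈ B : ‖σ(b_n⋯b_1, x)‖ > εn} ≤ D e^{−δn}. -/
open MeasureTheory Filter Topology
open scoped ENNReal NNReal

noncomputable section

lemma ldp_exp_bound (u : ℝ) : Real.exp u ≤ 1 + u + u ^ 2 * Real.exp |u| := by
  have h := Complex.norm_exp_sub_sum_le_norm_mul_exp (u : ℂ) 2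
  simp only [Finset.sum_range_succ, Finset.sum_range_zero] at h
  have e : (Complex.exp (u:ℂ) - (0 + (u:ℂ)^0/(Nat.factorial 0 : ℕ) + (u:ℂ)^1/(Nat.factorial 1 : ℕ))) = ((Real.exp u - (1 + u) : ℝ) : ℂ) := by
    push_cast; simp
  rw [e, Complex.norm_real, Complex.norm_real, Real.norm_eq_abs, Real.norm_eq_abs, sq_abs] at h
  linarith [le_abs_self (Real.exp u - (1 + u))]

lemma ldp_moment {G : Type*} [MeasurableSpace G] (μ : Measure G) [IsProbabilityMeasure μ]
    (N : G → ℝ) (hN0 : ∀ g, 0 ≤ N g) (hmom1 : Integrable N μ) (α : ℝ) (hα : 0 < α)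
    (hexp : Integrable (fun g => Real.exp (α * N g)) μ) (f : G → ℝ) (hf : Measurable f)
    (hfN : ∀ g, |f g| ≤ N g) (hf0 : ∫ g, f g ∂μ = 0) (t : ℝ) (ht : 0 < t) (htα : t ≤ α / 2) :
    ∫⁻ g, ENNReal.ofReal (Real.exp (t * f g)) ∂μ ≤
      ENNReal.ofReal (Real.exp (8 / α ^ 2 * (∫ g, Real.exp (α * N g) ∂μ) * t ^ 2)) := by
  have hfi : Integrable f μ := hmom1.mono' hf.aestronglyMeasurable (ae_of_all _ hfN)
  have key : ∀ g, Real.exp (t * f g) ≤ 1 + t * f g + t ^ 2 * (8 / α ^ 2) * Real.exp (α * N g) := by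
    intro g
    have h1 := ldp_exp_bound (t * f g)
    have h2 : |t * f g| ≤ α / 2 * N g := by
      rw [abs_mul, abs_of_pos ht]
      exact mul_le_mul htα (hfN g) (abs_nonneg _) (by positivity)
    have h3 : (t * f g) ^ 2 ≤ t ^ 2 * N g ^ 2 := by
      rw [mul_pow]
      gcongr ?_ * ?_
      rw [← sq_abs]
      exact pow_le_pow_left₀ (abs_nonneg _) (hfN g) 2
    have h4 : N g ^ 2 ≤ 8 / α ^ 2 * Real.exp (α / 2 * N g) := by
      have := Real.quadratic_le_exp_of_nonneg (x := α / 2 * N g) (by have := hN0 g; positivity)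
      have h5 : (α / 2 * N g) ^ 2 / 2 ≤ Real.exp (α / 2 * N g) := by
        have : 0 ≤ α / 2 * N g := by have := hN0 g; positivity
        linarith
      calc N g ^ 2 = 8 / α ^ 2 * ((α / 2 * N g) ^ 2 / 2) := by field_simp; ring
        _ ≤ _ := by gcongr
    have h6 : Real.exp (α * N g) = Real.exp (α / 2 * N g) * Real.exp (α / 2 * N g) := by
      rw [← Real.exp_add]; congr 1; ring
    calc Real.exp (t * f g) ≤ _ := h1
      _ ≤ 1 + t * f g + (t ^ 2 * (8 / α ^ 2 * Real.exp (α / 2 * N g))) * Real.exp (α / 2 * N g) := by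
          gcongr
          exact h3.trans (by gcongr)
      _ = _ := by rw [h6]; ring
  have hi : Integrable (fun g => 1 + t * f g + t ^ 2 * (8 / α ^ 2) * Real.exp (α * N g)) μ :=
    ((integrable_const _).add (hfi.const_mul t)).add (hexp.const_mul _)
  calc ∫⁻ g, ENNReal.ofReal (Real.exp (t * f g)) ∂μ
      ≤ ∫⁻ g, ENNReal.ofReal (1 + t * f g + t ^ 2 * (8 / α ^ 2) * Real.exp (α * N g)) ∂μ :=
        lintegral_mono fun g => ENNReal.ofReal_le_ofReal (key g)
    _ = ENNReal.ofReal (∫ g, (1 + t * f g + t ^ 2 * (8 / α ^ 2) * Real.exp (α * N g)) ∂μ) :=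
        (ofReal_integral_eq_lintegral_ofReal hi
          (ae_of_all _ fun g => (Real.exp_pos _).le.trans (key g))).symm
    _ ≤ _ := by
        apply ENNReal.ofReal_le_ofReal
        rw [integral_add (f := fun g => 1 + t * f g) ((integrable_const _).add (hfi.const_mul t)) (hexp.const_mul _),
          integral_add (integrable_const _) (hfi.const_mul t), integral_const_mul,
          integral_const_mul, hf0]
        simp only [integral_const, probReal_univ, smul_eq_mul, mul_zero, add_zero, mul_one]
        have := Real.add_one_le_exp (8 / α ^ 2 * (∫ g, Real.exp (α * N g) ∂μ) * t ^ 2)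
        linarith

lemma ldp_prodRev_meas {G : Type*} [Group G] [MeasurableSpace G] [MeasurableMul₂ G] (n : ℕ) :
    Measurable fun b : ℕ → G => prodRev b n := by
  induction n with
  | zero => exact measurable_const
  | succ n ih => exact (measurable_pi_apply n).mul ih

/-- Extend a finite word by ones. -/
def ldpExt {G : Type*} [Group G] (n : ℕ) (c : Fin n → G) : ℕ → G :=
  fun k => if h : k < n then c ⟨k, h⟩ else 1

lemma ldpExt_meas {G : Type*} [Group G] [MeasurableSpace G] (n : ℕ) :
    Measurable (ldpExt (G := G) n) := by
  refine measurable_pi_lambda _ fun k => ?_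
  unfold ldpExt
  by_cases h : k < n
  · simp only [h, dite_true]; exact measurable_pi_apply _
  · simp only [h, dite_false]; exact measurable_const

lemma ldp_prodRev_congr {G : Type*} [Group G] (b c : ℕ → G) (n : ℕ) (h : ∀ k < n, b k = c k) :
    prodRev b n = prodRev c n := by
  induction n with
  | zero => rfl
  | succ n ih =>
    simp only [prodRev]
    rw [h n (by omega), ih fun k hk => h k (by omega)]

lemma ldp_law {G : Type*} [Group G] [MeasurableSpace G] [MeasurableMul₂ G]
    (μ : Measure G) [IsProbabilityMeasure μ] (β : Measure (ℕ → G))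
    (hβ : ∀ n : ℕ, β.map (fun b (i : Fin n) => b i) = Measure.pi fun _ : Fin n => μ) (n : ℕ) :
    β.map (fun b => (b n, prodRev b n)) = μ.prod (β.map fun b => prodRev b n) := by
  have hm : ∀ n : ℕ, Measurable (fun (b : ℕ → G) (i : Fin n) => b i) := fun n =>
    measurable_pi_lambda _ fun i => measurable_pi_apply _
  have hP : Measurable fun c : Fin n → G => prodRev (ldpExt n c) n :=
    (ldp_prodRev_meas n).comp (ldpExt_meas n)
  have hR : (fun b : ℕ → G => prodRev b n) =
      (fun c : Fin n → G => prodRev (ldpExt n c) n) ∘ (fun (b : ℕ → G) (i : Fin n) => b i) := by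
    funext b
    refine ldp_prodRev_congr _ _ _ fun k hk => ?_
    simp [ldpExt, hk]
  have h1 := (measurePreserving_piFinSuccAbove (fun _ : Fin (n + 1) => μ) (Fin.last n)).map_eq
  rw [← hβ (n + 1), Measure.map_map (MeasurableEquiv.measurable _) (hm _), ← hβ n] at h1
  have : IsFiniteMeasure β := by
    have h := hβ n
    constructor
    have h2 : (β.map (fun b (i : Fin n) => b i)) Set.univ < ⊤ := by rw [h]; exact measure_lt_top _ _
    rwa [Measure.map_apply (hm n) MeasurableSet.univ, Set.preimage_univ] at h2
  rw [hR, ← Measure.map_map hP (hm n)]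
  conv_rhs => rw [← Measure.map_id (μ := μ)]
  rw [Measure.map_prod_map _ _ measurable_id hP, ← h1,
    Measure.map_map (measurable_id.prodMap hP) ((MeasurableEquiv.measurable _).comp (hm _))]
  congr 1
  funext b
  refine Prod.ext ?_ ?_
  · simp [MeasurableEquiv.piFinSuccAbove]
  · show prodRev b n = prodRev _ n
    refine ldp_prodRev_congr _ _ _ fun k hk => ?_
    simp [ldpExt, hk, MeasurableEquiv.piFinSuccAbove, Fin.removeNth]

lemma ldp_laplace
    {G : Type*} [Group G] [MeasurableSpace G] [MeasurableMul₂ G]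
    {X : Type*} [MeasurableSpace X]
    [MulAction G X] (hact : Measurable fun p : G × X => p.1 • p.2)
    (f : G → X → ℝ)
    (hfmeas : Measurable fun p : G × X => f p.1 p.2)
    (hcoc : ∀ g₁ g₂ : G, ∀ x : X, f (g₂ * g₁) x = f g₂ (g₁ • x) + f g₁ x)
    (μ : Measure G) [IsProbabilityMeasure μ]
    (β : Measure (ℕ → G)) [IsProbabilityMeasure β]
    (hβ : ∀ n : ℕ, β.map (fun b (i : Fin n) => b i) = Measure.pi fun _ : Fin n => μ)
    (t L : ℝ)
    (hL : ∀ x, ∫⁻ g, ENNReal.ofReal (Real.exp (t * f g x)) ∂μ ≤ ENNReal.ofReal (Real.exp L))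
    (n : ℕ) (x : X) :
    ∫⁻ b, ENNReal.ofReal (Real.exp (t * f (prodRev b n) x)) ∂β ≤
      ENNReal.ofReal (Real.exp (L * n)) := by
  have hfx : ∀ x, Measurable fun g => f g x := fun x => hfmeas.comp measurable_prodMk_right
  induction n with
  | zero =>
    have : f 1 x = 0 := by
      have := hcoc 1 1 x
      simp at this
      exact this
    simp [prodRev, this]
  | succ n ih =>
    have hax : Measurable fun h : G => h • x := hact.comp measurable_prodMk_right
    have hm : Measurable fun p : G × G => ENNReal.ofReal (Real.exp (t * f (p.1 * p.2) x)) :=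
      (Real.measurable_exp.comp (((hfx x).comp measurable_mul).const_mul t)).ennreal_ofReal
    have hpair : Measurable fun b : ℕ → G => (b n, prodRev b n) :=
      (measurable_pi_apply n).prodMk (ldp_prodRev_meas n)
    have hE : Measurable fun h => ENNReal.ofReal (Real.exp (t * f h x)) :=
      (Real.measurable_exp.comp ((hfx x).const_mul t)).ennreal_ofReal
    have : IsProbabilityMeasure (β.map fun b => prodRev b n) :=
      Measure.isProbabilityMeasure_map (ldp_prodRev_meas n).aemeasurable
    calc ∫⁻ b, ENNReal.ofReal (Real.exp (t * f (prodRev b (n + 1)) x)) ∂β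
        = ∫⁻ p, ENNReal.ofReal (Real.exp (t * f (p.1 * p.2) x))
            ∂(β.map fun b => (b n, prodRev b n)) := by
          rw [lintegral_map hm hpair]; rfl
      _ = ∫⁻ h, ∫⁻ g, ENNReal.ofReal (Real.exp (t * f (g * h) x)) ∂μ
            ∂(β.map fun b => prodRev b n) := by
          rw [ldp_law μ β hβ n, lintegral_prod_symm' _ hm]
      _ ≤ ∫⁻ h, ENNReal.ofReal (Real.exp L) * ENNReal.ofReal (Real.exp (t * f h x))
            ∂(β.map fun b => prodRev b n) := by
          refine lintegral_mono fun h => ?_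
          have e : ∀ g, ENNReal.ofReal (Real.exp (t * f (g * h) x)) =
              ENNReal.ofReal (Real.exp (t * f g (h • x))) *
                ENNReal.ofReal (Real.exp (t * f h x)) := by
            intro g
            rw [← ENNReal.ofReal_mul (Real.exp_pos _).le, ← Real.exp_add, hcoc]
            congr 2; ring
          simp only [e]
          have hmm : Measurable fun g => ENNReal.ofReal (Real.exp (t * f g (h • x))) :=
            (Real.measurable_exp.comp ((hfx (h • x)).const_mul t)).ennreal_ofReal
          rw [lintegral_mul_const _ hmm]
          gcongr
          exact hL _
      _ = ENNReal.ofReal (Real.exp L) *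
            ∫⁻ b, ENNReal.ofReal (Real.exp (t * f (prodRev b n) x)) ∂β := by
          rw [lintegral_const_mul _ hE, lintegral_map hE (ldp_prodRev_meas n)]
      _ ≤ ENNReal.ofReal (Real.exp L) * ENNReal.ofReal (Real.exp (L * n)) := by gcongr
      _ = _ := by
          rw [← ENNReal.ofReal_mul (Real.exp_pos _).le, ← Real.exp_add]
          congr 2; push_cast; ring

/-- principle of large deviations. -/
theorem large_deviations
    {G : Type*} [Group G] [MeasurableSpace G] [MeasurableMul₂ G]
    {X : Type*} [MetricSpace X] [CompactSpace X] [MeasurableSpace X] [BorelSpace X]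
    [MulAction G X] (hact : Measurable fun p : G × X => p.1 • p.2)
    {d : ℕ} (σ : G → X → EuclideanSpace ℝ (Fin d))
    (hσmeas : Measurable fun p : G × X => σ p.1 p.2)
    (hcoc : ∀ g₁ g₂ : G, ∀ x : X, σ (g₂ * g₁) x = σ g₂ (g₁ • x) + σ g₁ x)
    (N : G → ℝ) (hN0 : ∀ g, 0 ≤ N g) (hNsub : ∀ g h : G, N (g * h) ≤ N g + N h)
    (hNσ : ∀ g x, ‖σ g x‖ ≤ N g)
    (μ : Measure G) [IsProbabilityMeasure μ]
    (hmom1 : Integrable N μ)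
    (hdrift : ∀ x, ∫ g, σ g x ∂μ = 0)
    (hexp : ∃ α > (0 : ℝ), Integrable (fun g => Real.exp (α * N g)) μ)
    (β : Measure (ℕ → G)) [IsProbabilityMeasure β]
    (hβ : ∀ n : ℕ, β.map (fun b (i : Fin n) => b i) = Measure.pi fun _ : Fin n => μ) :
    ∀ ε > (0 : ℝ), ∃ D > (0 : ℝ), ∃ δ > (0 : ℝ), ∀ n : ℕ, 1 ≤ n → ∀ x : X,
      β {b | ε * n < ‖σ (prodRev b n) x‖} ≤ ENNReal.ofReal (D * Real.exp (-δ * n)) := by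
  obtain ⟨α, hα, hexp⟩ := hexp
  intro ε hε
  set η : ℝ := ε / (d + 1) with hη
  have hηpos : 0 < η := by positivity
  set K : ℝ := 8 / α ^ 2 * (∫ g, Real.exp (α * N g) ∂μ) with hK
  have hK0 : 0 ≤ K := mul_nonneg (by positivity) (integral_nonneg fun g => (Real.exp_pos _).le)
  set t : ℝ := min (α / 2) (η / (2 * (K + 1))) with ht
  have ht0 : 0 < t := lt_min (by positivity) (by positivity)
  have htα : t ≤ α / 2 := min_le_left _ _
  have htK : K * t ≤ η / 2 := by
    have h1 : t ≤ η / (2 * (K + 1)) := min_le_right _ _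
    rw [le_div_iff₀ (by positivity)] at h1
    nlinarith
  have lap : ∀ s : ℝ, |s| = 1 → ∀ i : Fin d, ∀ (n : ℕ) (x : X),
      ∫⁻ b, ENNReal.ofReal (Real.exp (t * (s * σ (prodRev b n) x i))) ∂β ≤
        ENNReal.ofReal (Real.exp (K * t ^ 2 * n)) := by
    intro s hs i n x
    have hm : Measurable fun p : G × X => s * σ p.1 p.2 i :=
      ((EuclideanSpace.proj (𝕜 := ℝ) i).continuous.measurable.comp hσmeas).const_mul s
    have hbd : ∀ g x, |s * σ g x i| ≤ N g := fun g x => by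
      rw [abs_mul, hs, one_mul]
      exact (PiLp.norm_apply_le (σ g x) i).trans (hNσ g x)
    refine ldp_laplace hact (fun g x => s * σ g x i) hm ?_ μ β hβ t (K * t ^ 2) ?_ n x
    · intro g₁ g₂ x
      rw [hcoc]; simp; ring
    · intro x
      refine ldp_moment μ N hN0 hmom1 α hα hexp (fun g => s * σ g x i)
        (hm.comp measurable_prodMk_right) (fun g => hbd g x) ?_ t ht0 htα
      have hσi : Integrable (fun g => σ g x) μ :=
        hmom1.mono' (hσmeas.comp measurable_prodMk_right).aestronglyMeasurable
          (ae_of_all _ fun g => hNσ g x)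
      have := (EuclideanSpace.proj (𝕜 := ℝ) i).integral_comp_comm hσi
      rw [hdrift x, map_zero] at this
      rw [integral_const_mul]
      have h0 : ∫ g, σ g x i ∂μ = 0 := this
      rw [h0, mul_zero]
  refine ⟨2 * d + 1, by positivity, t * η / 2, by positivity, fun n hn x => ?_⟩
  set F : Fin d → ℝ → (ℕ → G) → ℝ≥0∞ := fun i s b =>
    ENNReal.ofReal (Real.exp (t * (s * σ (prodRev b n) x i))) with hF
  have hFm : ∀ i s, Measurable (F i s) := fun i s => by
    have hm : Measurable fun p : G × X => s * σ p.1 p.2 i :=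
      ((EuclideanSpace.proj (𝕜 := ℝ) i).continuous.measurable.comp hσmeas).const_mul s
    have h2 : Measurable fun b : ℕ → G => s * σ (prodRev b n) x i :=
      hm.comp ((ldp_prodRev_meas n).prodMk measurable_const)
    exact (Real.measurable_exp.comp (h2.const_mul t)).ennreal_ofReal
  set c : ℝ := Real.exp (t * (η * n)) with hc
  have hsub : {b : ℕ → G | ε * n < ‖σ (prodRev b n) x‖} ⊆
      {b | ENNReal.ofReal c ≤ ∑ i, (F i 1 b + F i (-1) b)} := by
    intro b hb
    simp only [Set.mem_ofPred_eq] at hb ⊢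
    obtain ⟨i, hi⟩ : ∃ i, η * n < |σ (prodRev b n) x i| := by
      by_contra! hcon
      have h1 : ‖σ (prodRev b n) x‖ ≤ ∑ i, |σ (prodRev b n) x i| := by
        rw [EuclideanSpace.norm_eq]
        refine Real.sqrt_le_iff.2 ⟨Finset.sum_nonneg fun i _ => abs_nonneg _, ?_⟩
        exact Finset.sum_sq_le_sq_sum_of_nonneg fun i _ => abs_nonneg _
      have h2 : ∑ i, |σ (prodRev b n) x i| ≤ d * (η * n) := by
        refine (Finset.sum_le_sum fun i _ => hcon i).trans ?_
        simp
      have h3 : (d : ℝ) * (η * n) ≤ ε * n := by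
        have : (d + 1) * η = ε := by rw [hη]; field_simp
        have h4 : 0 ≤ η * n := by positivity
        calc (d : ℝ) * (η * n) ≤ (d + 1) * (η * n) := by linarith
          _ = _ := by rw [← mul_assoc, this]
      linarith
    refine le_trans ?_ (Finset.single_le_sum (f := fun i => F i 1 b + F i (-1) b)
      (fun _ _ => zero_le) (Finset.mem_univ i))
    rcases lt_abs.1 hi with h | h
    · refine le_trans ?_ le_self_add
      refine ENNReal.ofReal_le_ofReal (Real.exp_le_exp.2 ?_)
      exact mul_le_mul_of_nonneg_left (by linarith) ht0.le
    · refine le_trans ?_ le_add_self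
      refine ENNReal.ofReal_le_ofReal (Real.exp_le_exp.2 ?_)
      exact mul_le_mul_of_nonneg_left (by linarith) ht0.le
  have hcpos : 0 < c := Real.exp_pos _
  have hmk := meas_ge_le_lintegral_div (μ := β) (f := fun b => ∑ i, (F i 1 b + F i (-1) b))
    (Finset.measurable_sum _ fun i _ => (hFm i 1).add (hFm i (-1))).aemeasurable
    (ε := ENNReal.ofReal c) (by simpa using hcpos) ENNReal.ofReal_ne_top
  have hint : ∫⁻ b, ∑ i, (F i 1 b + F i (-1) b) ∂β ≤
      ENNReal.ofReal (2 * d * Real.exp (K * t ^ 2 * n)) := by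
    have hadd : ∀ i, Measurable fun b => F i 1 b + F i (-1) b :=
      fun i => (hFm i 1).add (hFm i (-1))
    rw [lintegral_finsetSum _ fun i _ => hadd i]
    calc ∑ i, ∫⁻ b, (F i 1 b + F i (-1) b) ∂β
        ≤ ∑ i : Fin d, ENNReal.ofReal (2 * Real.exp (K * t ^ 2 * n)) := by
          refine Finset.sum_le_sum fun i _ => ?_
          rw [lintegral_add_left (hFm i 1), two_mul,
            ENNReal.ofReal_add (Real.exp_pos _).le (Real.exp_pos _).le]
          exact add_le_add (lap 1 (by simp) i n x) (lap (-1) (by simp) i n x)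
      _ = _ := by
          rw [← ENNReal.ofReal_sum_of_nonneg fun i _ => by positivity]
          congr 1; simp; ring
  calc β {b | ε * n < ‖σ (prodRev b n) x‖} ≤ _ := measure_mono hsub
    _ ≤ _ := hmk
    _ ≤ ENNReal.ofReal (2 * d * Real.exp (K * t ^ 2 * n)) / ENNReal.ofReal c := by gcongr
    _ = ENNReal.ofReal (2 * d * Real.exp (K * t ^ 2 * n) / c) :=
        (ENNReal.ofReal_div_of_pos hcpos).symm
    _ ≤ _ := by
        apply ENNReal.ofReal_le_ofReal
        rw [mul_div_assoc, hc, ← Real.exp_sub]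
        have h5 : K * t ^ 2 * n - t * (η * n) ≤ -(t * η / 2) * n := by
          have : K * t * (t * n) ≤ η / 2 * (t * n) := by gcongr
          nlinarith
        gcongr
        linarith
end
end

section
/- Assume d = 1 and that σ has drift at least 1: ∫_G σ(g,x) dμ(g) ≥ 1 for every x ∈ X. Then for every x ∈ X and s > 0 the exit time τ_s(·,x) is β-almost surely finite, and the overshoot is uniformly tight: sup_{x∈X, s>0} β{b ∈ B : S_{τ_s(b,x)}(b,x) > s + R} → 0 as R → ∞. -/
open MeasureTheory Filter Topology
open scoped ENNReal NNReal

noncomputable section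

/-- The exit time `τ_s(b, x) = inf {n ≥ 1 : σ(b_n ⋯ b_1, x) ≥ s}`. -/
def exitTime {G : Type*} [Monoid G] {X : Type*} (σ : G → X → ℝ) (s : ℝ)
    (b : ℕ → G) (x : X) : ℕ :=
  sInf {n : ℕ | 1 ≤ n ∧ s ≤ σ (prodRev b n) x}

namespace Overshoot

/-- keep the first `n` coordinates, replace the others by `1`. -/
def ext1 {G : Type*} [One G] (n : ℕ) (c : Fin n → G) : ℕ → G :=
  fun k => if h : k < n then c ⟨k, h⟩ else 1

lemma measurable_ext1 {G : Type*} [One G] [MeasurableSpace G] (n : ℕ) :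
    Measurable (ext1 n : (Fin n → G) → (ℕ → G)) := by
  refine measurable_pi_iff.2 fun k => ?_
  unfold ext1
  by_cases h : k < n
  · simp only [h, dif_pos]
    exact measurable_pi_apply _
  · simp only [h, dif_neg, not_false_eq_true]
    exact measurable_const

lemma measurable_prodRev {G : Type*} [Monoid G] [MeasurableSpace G] [MeasurableMul₂ G] (n : ℕ) :
    Measurable (fun b : ℕ → G => prodRev b n) := by
  induction n with
  | zero => exact measurable_const
  | succ n ih => exact (measurable_pi_apply n).mul ih

lemma prodRev_congr {G : Type*} [Monoid G] {b c : ℕ → G} (n : ℕ) (h : ∀ k < n, b k = c k) :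
    prodRev b n = prodRev c n := by
  induction n with
  | zero => rfl
  | succ n ih =>
    simp only [prodRev]
    rw [h n (Nat.lt_succ_self n), ih fun k hk => h k (Nat.lt_succ_of_lt hk)]

lemma prodRev_ext1 {G : Type*} [Monoid G] (b : ℕ → G) {n k : ℕ} (hk : k ≤ n) :
    prodRev (ext1 n fun i : Fin n => b i) k = prodRev b k := by
  apply prodRev_congr
  intro j hj
  simp [ext1, lt_of_lt_of_le hj hk]

lemma lintegral_step {G : Type*} [Group G] [MeasurableSpace G]
    (μ : Measure G) [IsProbabilityMeasure μ]
    (β : Measure (ℕ → G))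
    (hβ : ∀ n : ℕ, β.map (fun b (i : Fin n) => b i) = Measure.pi fun _ : Fin n => μ)
    (n : ℕ) (H : G × (Fin n → G) → ℝ≥0∞) (hH : Measurable H) :
    ∫⁻ b, H (b n, fun i : Fin n => b i) ∂β
      = ∫⁻ b, ∫⁻ g, H (g, fun i : Fin n => b i) ∂μ ∂β := by
  have hr : ∀ m : ℕ, Measurable (fun (b : ℕ → G) (i : Fin m) => b i) := fun m =>
    measurable_pi_iff.2 fun i => measurable_pi_apply _
  have mp := measurePreserving_piFinSuccAbove (fun _ : Fin (n+1) => μ) (Fin.last n)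
  have h1 : ∫⁻ b, H (b n, fun i : Fin n => b i) ∂β
      = ∫⁻ c, H (MeasurableEquiv.piFinSuccAbove (fun _ => G) (Fin.last n) c)
          ∂(Measure.pi fun _ : Fin (n+1) => μ) := by
    rw [← hβ (n+1), lintegral_map
      (f := fun c => H (MeasurableEquiv.piFinSuccAbove (fun _ => G) (Fin.last n) c))
      (hH.comp (MeasurableEquiv.measurable _)) (hr _)]
    refine lintegral_congr fun b => ?_
    congr 1
    ext i
    · simp [MeasurableEquiv.piFinSuccAbove, Fin.insertNthEquiv]
    · simp [MeasurableEquiv.piFinSuccAbove, Fin.insertNthEquiv, Fin.init]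
  rw [h1, mp.lintegral_comp hH, lintegral_prod_symm _ hH.aemeasurable, ← hβ n,
    lintegral_map hH.lintegral_prod_left' (hr n)]

/-- not exited by time `n` -/
def alive {G : Type*} [Monoid G] {X : Type*} (σ : G → X → ℝ) (s : ℝ) (x : X) (n : ℕ) :
    Set (ℕ → G) := {b | ∀ k ≤ n, σ (prodRev b k) x < s}

lemma alive_succ {G : Type*} [Monoid G] {X : Type*} (σ : G → X → ℝ) (s : ℝ) (x : X) (n : ℕ)
    (b : ℕ → G) : b ∈ alive σ s x (n+1) ↔ b ∈ alive σ s x n ∧ σ (prodRev b (n+1)) x < s := by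
  simp only [alive, Set.mem_ofPred_eq]
  constructor
  · intro h
    exact ⟨fun k hk => h k (by omega), h _ le_rfl⟩
  · rintro ⟨h, h'⟩ k hk
    rcases Nat.lt_or_ge n k with h2 | h2
    · obtain rfl : k = n+1 := by omega
      exact h'
    · exact h k h2

lemma key {G : Type*} [Group G] [MeasurableSpace G] [MeasurableMul₂ G]
    {X : Type*} [MeasurableSpace X] [MulAction G X]
    (σ : G → X → ℝ)
    (hσmeas : Measurable fun p : G × X => σ p.1 p.2)
    (hcoc : ∀ g₁ g₂ : G, ∀ x : X, σ (g₂ * g₁) x = σ g₂ (g₁ • x) + σ g₁ x)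
    (μ : Measure G) [IsProbabilityMeasure μ]
    (β : Measure (ℕ → G)) [IsProbabilityMeasure β]
    (hβ : ∀ n : ℕ, β.map (fun b (i : Fin n) => b i) = Measure.pi fun _ : Fin n => μ)
    (s : ℝ) (x : X) (v e : ℝ → ℝ≥0∞) (hv : Measurable v) (he : Measurable e)
    (hstep : ∀ y t, t < s →
      ∫⁻ g, (e (t + σ g y) + (Set.Iio s).indicator v (t + σ g y)) ∂μ ≤ v t) :
    ∑' n, ∫⁻ b, (alive σ s x n).indicator (fun b => e (σ (prodRev b (n+1)) x)) b ∂β ≤ v 0 := by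
  have hσx : Measurable fun g => σ g x := hσmeas.comp measurable_prodMk_right
  have hS : ∀ k, Measurable fun b : ℕ → G => σ (prodRev b k) x := fun k =>
    hσx.comp (measurable_prodRev k)
  have hA : ∀ n, MeasurableSet (alive σ s x n : Set (ℕ → G)) := by
    intro n
    have : (alive σ s x n : Set (ℕ → G)) = ⋂ k ∈ Set.Iic n, {b | σ (prodRev b k) x < s} := by
      ext b; simp [alive]
    rw [this]
    exact MeasurableSet.biInter (Set.to_countable _) fun k _ =>
      measurableSet_lt (hS k) measurable_const
  have h1 : σ 1 x = 0 := by
    have := hcoc 1 1 x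
    simp at this
    exact this
  set a : ℕ → ℝ≥0∞ := fun n =>
    ∫⁻ b, (alive σ s x n).indicator (fun b => v (σ (prodRev b n) x)) b ∂β with ha
  set q : ℕ → ℝ≥0∞ := fun n =>
    ∫⁻ b, (alive σ s x n).indicator (fun b => e (σ (prodRev b (n+1)) x)) b ∂β with hq
  have hone : ∀ n, q n + a (n+1) ≤ a n := by
    intro n
    let w : ℝ → ℝ≥0∞ := fun t => e t + (Set.Iio s).indicator v t
    have hw : Measurable w := he.add (hv.indicator measurableSet_Iio)
    let H : G × (Fin n → G) → ℝ≥0∞ := fun p =>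
      (Prod.snd ⁻¹' (ext1 n ⁻¹' alive σ s x n)).indicator
        (fun p => w (σ (p.1 * prodRev (ext1 n p.2) n) x)) p
    have hH : Measurable H := by
      refine Measurable.indicator ?_ ((hA n).preimage (measurable_ext1 n) |>.preimage measurable_snd)
      exact hw.comp (hσx.comp (measurable_fst.mul
        ((measurable_prodRev n).comp ((measurable_ext1 n).comp measurable_snd))))
    have hmem : ∀ b : ℕ → G, (ext1 n fun i : Fin n => b i) ∈ alive σ s x n ↔
        b ∈ alive σ s x n := by
      intro b
      simp only [alive, Set.mem_ofPred_eq]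
      refine forall_congr' fun k => forall_congr' fun hk => ?_
      rw [prodRev_ext1 b hk]
    have hval : ∀ (g : G) (b : ℕ → G), H (g, fun i : Fin n => b i) =
        (alive σ s x n).indicator (fun b => w (σ (g * prodRev b n) x)) b := by
      intro g b
      by_cases h : b ∈ alive σ s x n
      · have h2 : (g, fun i : Fin n => b i) ∈ Prod.snd ⁻¹' (ext1 n ⁻¹' alive σ s x n) :=
          (hmem b).2 h
        simp only [H]
        rw [Set.indicator_of_mem h, Set.indicator_of_mem h2, prodRev_ext1 b le_rfl]
      · have h2 : (g, fun i : Fin n => b i) ∉ Prod.snd ⁻¹' (ext1 n ⁻¹' alive σ s x n) :=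
          fun hh => h ((hmem b).1 hh)
        simp only [H]
        rw [Set.indicator_of_notMem h, Set.indicator_of_notMem h2]
    have e1 : q n + a (n+1) = ∫⁻ b, H (b n, fun i : Fin n => b i) ∂β := by
      simp only [hq, ha]
      have hm : Measurable (fun b => (alive σ s x n).indicator
          (fun b => e (σ (prodRev b (n+1)) x)) b) :=
        (he.comp (hS (n+1))).indicator (hA n)
      rw [← lintegral_add_left hm]
      refine lintegral_congr fun b => ?_
      rw [hval]
      by_cases h : b ∈ alive σ s x n
      · rw [Set.indicator_of_mem h, Set.indicator_of_mem h]
        simp only [w]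
        by_cases h' : σ (prodRev b (n+1)) x < s
        · rw [Set.indicator_of_mem ((alive_succ σ s x n b).2 ⟨h, h'⟩)]
          have h2 : σ (b n * prodRev b n) x ∈ Set.Iio s := h'
          rw [Set.indicator_of_mem h2]
          rfl
        · rw [Set.indicator_of_notMem fun hh => h' ((alive_succ σ s x n b).1 hh).2]
          have h2 : σ (b n * prodRev b n) x ∉ Set.Iio s := h'
          rw [Set.indicator_of_notMem h2]
          rfl
      · rw [Set.indicator_of_notMem h, Set.indicator_of_notMem h,
          Set.indicator_of_notMem fun hh => h ((alive_succ σ s x n b).1 hh).1, add_zero]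
    rw [e1, lintegral_step μ β hβ n H hH]
    refine lintegral_mono fun b => ?_
    simp only [hval]
    by_cases h : b ∈ alive σ s x n
    · simp only [Set.indicator_of_mem h, hcoc]
      have := hstep (prodRev b n • x) (σ (prodRev b n) x) (h n le_rfl)
      refine le_trans (le_of_eq ?_) this
      refine lintegral_congr fun g => ?_
      rw [add_comm]
    · simp [h]
  have hsum : ∀ n, ∑ k ∈ Finset.range n, q k + a n ≤ v 0 := by
    intro n
    induction n with
    | zero =>
      simp only [Finset.range_zero, Finset.sum_empty, zero_add, ha]
      calc _ ≤ ∫⁻ b, v 0 ∂β := by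
            refine lintegral_mono fun b => ?_
            refine (Set.indicator_le_self _ _ b).trans ?_
            simp [prodRev, h1]
        _ = v 0 := by simp
    | succ n ih =>
      rw [Finset.sum_range_succ, add_assoc]
      exact (add_le_add le_rfl (hone n)).trans ih
  rw [ENNReal.tsum_eq_iSup_nat]
  exact iSup_le fun n => le_self_add.trans (hsum n)

/-- comparison of a lower integral with a real bound -/
lemma lint_le {G : Type*} [MeasurableSpace G] (μ : Measure G) (f : G → ℝ≥0∞) (k : G → ℝ) (c : ℝ)
    (hk : Integrable k μ) (hk0 : ∀ g, 0 ≤ k g) (hf : ∀ g, f g ≤ ENNReal.ofReal (k g))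
    (hc : ∫ g, k g ∂μ ≤ c) : ∫⁻ g, f g ∂μ ≤ ENNReal.ofReal c := by
  calc _ ≤ ∫⁻ g, ENNReal.ofReal (k g) ∂μ := lintegral_mono hf
    _ = ENNReal.ofReal (∫ g, k g ∂μ) :=
      (ofReal_integral_eq_lintegral_ofReal hk (ae_of_all _ hk0)).symm
    _ ≤ _ := ENNReal.ofReal_le_ofReal hc

section D
variable {G : Type*} [MeasurableSpace G] (μ : Measure G) [IsProbabilityMeasure μ] (N : G → ℝ)

/-- the integrated tail -/
def D (u : ℝ) : ℝ := ∫ h, max (N h - u) 0 ∂μ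

variable {N}

lemma D_int (hN : Integrable N μ) (u : ℝ) : Integrable (fun h => max (N h - u) 0) μ :=
  (hN.sub (integrable_const u)).sup (integrable_const 0)

lemma D_anti (hN : Integrable N μ) : Antitone (D μ N) := by
  intro u u' h
  refine integral_mono (D_int μ hN u') (D_int μ hN u) fun g => ?_
  exact max_le_max (by linarith) le_rfl

lemma D_nonneg (u : ℝ) : 0 ≤ D μ N u := integral_nonneg fun _ => le_max_right _ _

lemma nullM (hN : Integrable N μ) (u : ℝ) : NullMeasurableSet {h | u < N h} μ :=
  nullMeasurableSet_lt aemeasurable_const hN.aemeasurable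

lemma D_sub (hN : Integrable N μ) (u y : ℝ) :
    D μ N u + y * μ.real {h | u < N h} ≤ D μ N (u - y) := by
  have hi : Integrable ({h | u < N h}.indicator fun _ => y) μ :=
    (integrable_const y).indicator₀ (nullM μ hN u)
  have : y * μ.real {h | u < N h} = ∫ h, {h | u < N h}.indicator (fun _ => y) h ∂μ := by
    rw [integral_indicator₀ (nullM μ hN u), setIntegral_const, smul_eq_mul, mul_comm]
  rw [this, D, D, ← integral_add (D_int μ hN u) hi]
  refine integral_mono ((D_int μ hN u).add hi) (D_int μ hN _) fun g => ?_
  by_cases h : u < N g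
  · simp only [Set.indicator, Set.mem_ofPred_eq, h, if_true]
    rw [max_eq_left (by linarith)]
    exact le_trans (by linarith) (le_max_left _ _)
  · simp only [Set.indicator, Set.mem_ofPred_eq, h, if_false]
    rw [max_eq_right (by linarith)]
    simp

lemma D_tendsto (hN : Integrable N μ) (hN0 : ∀ g, 0 ≤ N g) :
    ∀ ε > 0, ∃ M : ℝ, 0 ≤ M ∧ D μ N M < ε := by
  intro ε hε
  have ht : Tendsto (fun n : ℕ => D μ N n) atTop (𝓝 0) := by
    have := tendsto_integral_of_dominated_convergence (μ := μ)
      (F := fun (n : ℕ) h => max (N h - n) 0) (f := fun _ => 0) N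
      (fun n => (D_int μ hN n).aestronglyMeasurable) hN
      (fun n => ae_of_all _ fun h => by
        rw [Real.norm_of_nonneg (le_max_right _ _)]
        refine max_le ?_ (hN0 h)
        have : (0:ℝ) ≤ n := Nat.cast_nonneg n
        linarith)
      (ae_of_all _ fun h => by
        obtain ⟨m, hm⟩ := exists_nat_ge (N h)
        refine tendsto_const_nhds.congr' ?_
        filter_upwards [eventually_ge_atTop m] with n hn
        have : (m:ℝ) ≤ n := by exact_mod_cast hn
        rw [max_eq_right (by linarith)])
    simpa [D] using this
  obtain ⟨n, hn⟩ := (ht.eventually (gt_mem_nhds hε)).exists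
  exact ⟨n, Nat.cast_nonneg n, hn⟩
end D

end Overshoot
open Overshoot

/-- finiteness of the exit time and uniform control of the overshoot. -/
theorem overshoot_control
    {G : Type*} [Group G] [MeasurableSpace G] [MeasurableMul₂ G]
    {X : Type*} [MetricSpace X] [CompactSpace X] [MeasurableSpace X] [BorelSpace X]
    [MulAction G X] (hact : Measurable fun p : G × X => p.1 • p.2)
    (σ : G → X → ℝ)
    (hσmeas : Measurable fun p : G × X => σ p.1 p.2)
    (hcoc : ∀ g₁ g₂ : G, ∀ x : X, σ (g₂ * g₁) x = σ g₂ (g₁ • x) + σ g₁ x)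
    (N : G → ℝ) (hN0 : ∀ g, 0 ≤ N g) (hNsub : ∀ g h : G, N (g * h) ≤ N g + N h)
    (hNσ : ∀ g x, |σ g x| ≤ N g)
    (μ : Measure G) [IsProbabilityMeasure μ]
    (hmom1 : Integrable N μ)
    (hdrift : ∀ x, (1 : ℝ) ≤ ∫ g, σ g x ∂μ)
    (β : Measure (ℕ → G)) [IsProbabilityMeasure β]
    (hβ : ∀ n : ℕ, β.map (fun b (i : Fin n) => b i) = Measure.pi fun _ : Fin n => μ) :
    (∀ x : X, ∀ s > (0 : ℝ), ∀ᵐ b ∂β, ∃ n : ℕ, 1 ≤ n ∧ s ≤ σ (prodRev b n) x) ∧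
    ∀ ε > (0 : ℝ), ∃ R₀ : ℝ, ∀ R ≥ R₀, ∀ x : X, ∀ s > (0 : ℝ),
      β {b | s + R < σ (prodRev b (exitTime σ s b x)) x} ≤ ENNReal.ofReal ε := by
  have hσy : ∀ y, Measurable fun g => σ g y := fun y => hσmeas.comp measurable_prodMk_right
  have hσint : ∀ y, Integrable (fun g => σ g y) μ := fun y =>
    hmom1.mono' (hσy y).aestronglyMeasurable (ae_of_all _ fun g => hNσ g y)
  obtain ⟨M, hM0, hM⟩ := D_tendsto μ hmom1 hN0 (1/2) (by norm_num)
  have hmint : ∀ y, Integrable (fun g => min (σ g y) M) μ := fun y =>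
    (hσint y).inf (integrable_const M)
  have hmdrift : ∀ y, 1/2 ≤ ∫ g, min (σ g y) M ∂μ := by
    intro y
    have h1 : ∫ g, (σ g y - max (N g - M) 0) ∂μ ≤ ∫ g, min (σ g y) M ∂μ := by
      refine integral_mono ((hσint y).sub (D_int μ hmom1 M)) (hmint y) fun g => ?_
      have h2 := (abs_le.1 (hNσ g y)).2
      have h3 := le_max_left (N g - M) 0
      have h4 := le_max_right (N g - M) 0
      exact le_min (by linarith) (by linarith)
    rw [integral_sub (hσint y) (D_int μ hmom1 M)] at h1
    have := hdrift y
    have h5 : ∫ g, max (N g - M) 0 ∂μ = D μ N M := rfl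
    linarith
  have hone : ∀ x, σ 1 x = 0 := by
    intro x
    have := hcoc 1 1 x
    simp at this
    exact this
  constructor
  · intro x s hs
    have hk := key σ hσmeas hcoc μ β hβ s x (fun t => ENNReal.ofReal (s + M - t))
      (fun _ => ENNReal.ofReal (1/2)) (by fun_prop) measurable_const (by
        intro y t ht
        refine lint_le μ _ (fun g => 1/2 + (s + M - t - min (σ g y) M)) _ ?_ ?_ ?_ ?_
        · exact (integrable_const _).add ((integrable_const _).sub (hmint y))
        · intro g
          have := min_le_right (σ g y) M
          linarith
        · intro g
          have h1 := min_le_right (σ g y) M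
          have h2 := min_le_left (σ g y) M
          rw [ENNReal.ofReal_add (by norm_num) (by linarith)]
          refine add_le_add le_rfl ?_
          by_cases h : t + σ g y < s
          · simp only [Set.indicator, Set.mem_Iio, h, if_true]
            exact ENNReal.ofReal_le_ofReal (by linarith)
          · simp [Set.indicator, h]
        · have hi3 : Integrable (fun g => s + M - t - min (σ g y) M) μ :=
            (integrable_const _).sub (hmint y)
          rw [integral_add (integrable_const _) hi3,
            integral_sub (integrable_const _) (hmint y)]
          simp only [integral_const, probReal_univ, one_smul]
          have := hmdrift y
          linarith)
    rw [ae_iff]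
    have hsub : ∀ n, {b | ¬ ∃ n : ℕ, 1 ≤ n ∧ s ≤ σ (prodRev b n) x} ⊆ alive σ s x n := by
      intro n b hb k hk
      rcases Nat.eq_zero_or_pos k with rfl | h0
      · simpa [prodRev, hone] using hs
      · by_contra h
        exact hb ⟨k, h0, not_lt.1 h⟩
    by_contra hne
    set Z := {b | ¬ ∃ n : ℕ, 1 ≤ n ∧ s ≤ σ (prodRev b n) x}
    have hZ : ∀ n, ENNReal.ofReal (1/2) * β Z ≤
        ∫⁻ b, (alive σ s x n).indicator (fun _ => ENNReal.ofReal (1/2)) b ∂β := by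
      intro n
      calc _ ≤ ENNReal.ofReal (1/2) * β {b | ENNReal.ofReal (1/2) ≤
              (alive σ s x n).indicator (fun _ => ENNReal.ofReal (1/2)) b} := by
            gcongr
            intro b hb
            simp [Set.indicator, hsub n hb]
        _ ≤ _ := by
            refine mul_meas_ge_le_lintegral ?_ _
            refine measurable_const.indicator ?_
            have : (alive σ s x n : Set (ℕ → G))
                = ⋂ k ∈ Set.Iic n, {b | σ (prodRev b k) x < s} := by
              ext b; simp [alive]
            rw [this]
            exact MeasurableSet.biInter (Set.to_countable _) fun k _ =>
              measurableSet_lt ((hσy x).comp (measurable_prodRev k)) measurable_const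
    have hle := (ENNReal.tsum_le_tsum hZ).trans hk
    rw [ENNReal.tsum_const_eq_top_of_ne_zero (mul_ne_zero (by simp) hne)] at hle
    exact ENNReal.ofReal_ne_top (top_le_iff.1 hle)
  · intro ε hε
    obtain ⟨K, hK0, hK⟩ := D_tendsto μ hmom1 hN0 (ε/2) (by linarith)
    refine ⟨K + M, fun R hR x s hs => ?_⟩
    have hDm : Measurable (D μ N) := (D_anti μ hmom1).measurable
    have hk := key σ hσmeas hcoc μ β hβ s x
      (fun t => ENNReal.ofReal (2 * (D μ N (R - M) - D μ N (s + R - t))))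
      ((Set.Ioi (s + R)).indicator fun _ => 1)
      (by fun_prop) (measurable_const.indicator measurableSet_Ioi) (by
        intro y t ht
        set u := s + R - t with hu
        have hind : Integrable ({h | u < N h}.indicator fun _ => (1:ℝ)) μ :=
          (integrable_const 1).indicator₀ (nullM μ hmom1 u)
        have hF0 : 0 ≤ μ.real {h | u < N h} := measureReal_nonneg
        have hmono : ∀ g, D μ N (u - min (σ g y) M) ≤ D μ N (R - M) := fun g =>
          D_anti μ hmom1 (by have := min_le_right (σ g y) M; linarith)
        have hi2 : Integrable (fun g => 2 * (D μ N (R - M) - D μ N u) -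
            2 * μ.real {h | u < N h} * min (σ g y) M) μ :=
          (integrable_const _).sub ((hmint y).const_mul _)
        have hpos : ∀ g, 0 ≤ 2 * (D μ N (R - M) - D μ N u) -
            2 * μ.real {h | u < N h} * min (σ g y) M := by
          intro g
          have h1 := D_sub μ hmom1 u (min (σ g y) M)
          have h2 := hmono g
          linarith
        have hind0 : ∀ g, 0 ≤ {h | u < N h}.indicator (fun _ => (1:ℝ)) g := fun g =>
          Set.indicator_nonneg (fun _ _ => zero_le_one) g
        refine lint_le μ _ (fun g => {h | u < N h}.indicator (fun _ => (1:ℝ)) g +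
          (2 * (D μ N (R - M) - D μ N u) -
            2 * μ.real {h | u < N h} * min (σ g y) M)) _ (hind.add hi2) ?_ ?_ ?_
        · exact fun g => add_nonneg (hind0 g) (hpos g)
        · intro g
          rw [ENNReal.ofReal_add (hind0 g) (hpos g)]
          refine add_le_add ?_ ?_
          · by_cases h : s + R < t + σ g y
            · have : u < N g := by
                have := (abs_le.1 (hNσ g y)).2
                linarith
              simp [Set.indicator, h, this]
            · simp [Set.indicator, h]
          · by_cases h : t + σ g y < s
            · simp only [Set.indicator, Set.mem_Iio, h, if_true]
              refine ENNReal.ofReal_le_ofReal ?_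
              have h1 := D_sub μ hmom1 u (min (σ g y) M)
              have h2 : D μ N (u - min (σ g y) M) ≤ D μ N (s + R - (t + σ g y)) :=
                D_anti μ hmom1 (by have := min_le_left (σ g y) M; linarith)
              linarith
            · simp [Set.indicator, h]
        · rw [integral_add hind hi2,
            integral_sub (integrable_const _) ((hmint y).const_mul _), integral_const_mul (2 * μ.real {h | u < N h}),
            integral_indicator₀ (nullM μ hmom1 u), setIntegral_const]
          simp only [integral_const, probReal_univ, smul_eq_mul, mul_one, one_mul, measureReal_restrict_apply_univ]
          have := mul_le_mul_of_nonneg_left (hmdrift y) hF0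
          linarith)
    have hsub : {b | s + R < σ (prodRev b (exitTime σ s b x)) x} ⊆
        ⋃ n, alive σ s x n ∩ {b | s + R < σ (prodRev b (n+1)) x} := by
      intro b hb
      simp only [Set.mem_ofPred_eq] at hb
      have hne : {n : ℕ | 1 ≤ n ∧ s ≤ σ (prodRev b n) x}.Nonempty := by
        by_contra h
        rw [Set.not_nonempty_iff_eq_empty] at h
        rw [exitTime, h, Nat.sInf_empty] at hb
        simp only [prodRev, hone] at hb
        linarith
      have hmem := Nat.sInf_mem hne
      obtain ⟨m, hm⟩ : ∃ m, exitTime σ s b x = m + 1 :=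
        Nat.exists_eq_succ_of_ne_zero (by have := hmem.1; unfold exitTime; omega)
      rw [hm] at hb
      refine Set.mem_iUnion.2 ⟨m, fun k hk => ?_, hb⟩
      rcases Nat.eq_zero_or_pos k with rfl | h0
      · simpa [prodRev, hone] using hs
      · by_contra h
        have h2 : exitTime σ s b x ≤ k := Nat.sInf_le ⟨h0, not_lt.1 h⟩
        omega
    have hms : ∀ n, MeasurableSet
        (alive σ s x n ∩ {b : ℕ → G | s + R < σ (prodRev b (n+1)) x}) := by
      intro n
      refine MeasurableSet.inter ?_
        (measurableSet_lt measurable_const ((hσy x).comp (measurable_prodRev _)))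
      have : (alive σ s x n : Set (ℕ → G))
          = ⋂ k ∈ Set.Iic n, {b | σ (prodRev b k) x < s} := by
        ext b; simp [alive]
      rw [this]
      exact MeasurableSet.biInter (Set.to_countable _) fun k _ =>
        measurableSet_lt ((hσy x).comp (measurable_prodRev k)) measurable_const
    calc _ ≤ β (⋃ n, alive σ s x n ∩ {b | s + R < σ (prodRev b (n+1)) x}) := measure_mono hsub
      _ ≤ ∑' n, β (alive σ s x n ∩ {b | s + R < σ (prodRev b (n+1)) x}) := measure_iUnion_le _
      _ = _ := by
        refine tsum_congr fun n => ?_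
        rw [← lintegral_indicator_one (hms n)]
        refine lintegral_congr fun b => ?_
        by_cases h : b ∈ alive σ s x n
        · rw [Set.indicator_of_mem h]
          by_cases h' : s + R < σ (prodRev b (n+1)) x
          · have h2 : b ∈ alive σ s x n ∩ {b | s + R < σ (prodRev b (n+1)) x} := ⟨h, h'⟩
            rw [Set.indicator_of_mem h2, Set.indicator_of_mem (Set.mem_Ioi.2 h')]
            rfl
          · rw [Set.indicator_of_notMem fun hh => h' hh.2,
              Set.indicator_of_notMem fun hh => h' (Set.mem_Ioi.1 hh)]
        · rw [Set.indicator_of_notMem h, Set.indicator_of_notMem fun hh => h hh.1]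
      _ ≤ _ := hk
      _ ≤ _ := by
        refine ENNReal.ofReal_le_ofReal ?_
        have h1 := D_nonneg μ (N := N) (s + R - 0)
        have h2 : D μ N (R - M) ≤ D μ N K := D_anti μ hmom1 (by linarith)
        linarith
end
end
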